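/- Let E be a closed real-linear subspace of S₂(H) with [X, [X, Y]] ∈ E for all X, Y ∈ E, and let p₁, p₂ ∈ P. If q₁, q₂ ∈ exp E satisfy d(pᵢ, qᵢ) = inf{ d(pᵢ, e) : e ∈ exp E } for i = 1, 2, then d(q₁, q₂) ≤ d(p₁, p₂); i.e., the nearest-point projection of P onto exp E is 1-Lipschitz (in particular continuous). -/

import Mathlib

noncomputable section

open scoped InnerProductSpace

variable {H : Type*} [NormedAddCommGroup H] [InnerProductSpace ℂ H] [CompleteSpace H]
variable {ι : Type*}

/-- `A` is a Hilbert–Schmidt operator (w.r.t. the Hilbert basis `e`). -/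
def IsHS (e : HilbertBasis ι ℂ H) (A : H →L[ℂ] H) : Prop :=
  Summable fun i => ‖A (e i)‖ ^ 2

/-- The Hilbert–Schmidt norm of `A` (w.r.t. the Hilbert basis `e`). -/
def hsNorm (e : HilbertBasis ι ℂ H) (A : H →L[ℂ] H) : ℝ :=
  Real.sqrt (∑' i, ‖A (e i)‖ ^ 2)

/-- The real Hilbert–Schmidt inner product `⟨A, B⟩₂ = ∑ ⟪A eᵢ, B eᵢ⟫`. -/
def hsInner (e : HilbertBasis ι ℂ H) (A B : H →L[ℂ] H) : ℝ :=
  (∑' i, (inner ℂ (A (e i)) (B (e i)) : ℂ)).re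

/-- The trace of an operator, `Tr T = ∑ ⟪eᵢ, T eᵢ⟫`. -/
def opTrace (e : HilbertBasis ι ℂ H) (T : H →L[ℂ] H) : ℂ :=
  ∑' i, (inner ℂ (e i) (T (e i)) : ℂ)

/-- `T` is trace class: it is the product of two Hilbert–Schmidt operators. -/
def IsTraceClass (e : HilbertBasis ι ℂ H) (T : H →L[ℂ] H) : Prop :=
  ∃ B C : H →L[ℂ] H, IsHS e B ∧ IsHS e C ∧ T = B * C

/-- `A ∈ S₂(H)`: self-adjoint and Hilbert–Schmidt. -/
def MemS2 (e : HilbertBasis ι ℂ H) (A : H →L[ℂ] H) : Prop :=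
  IsSelfAdjoint A ∧ IsHS e A

/-- `p ∈ P`: self-adjoint, positive definite (invertible and `⟪p x, x⟫ ≥ 0`),
with `p - 1` Hilbert–Schmidt. -/
def MemP (e : HilbertBasis ι ℂ H) (p : H →L[ℂ] H) : Prop :=
  IsSelfAdjoint p ∧ IsUnit p ∧ (∀ x : H, 0 ≤ (inner ℂ (p x) x : ℂ).re) ∧ IsHS e (p - 1)

/-- `x ∈ GL₂(H)`: invertible with `x - 1` Hilbert–Schmidt. -/
def MemGL2 (e : HilbertBasis ι ℂ H) (x : H →L[ℂ] H) : Prop :=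
  IsUnit x ∧ IsHS e (x - 1)

/-- `x ∈ U₂(H)`: unitary with `x - 1` Hilbert–Schmidt. -/
def MemU2 (e : HilbertBasis ι ℂ H) (x : H →L[ℂ] H) : Prop :=
  x ∈ unitary (H →L[ℂ] H) ∧ IsHS e (x - 1)

/-- `p^{1/2}`, via continuous functional calculus. -/
def psqrt (p : H →L[ℂ] H) : H →L[ℂ] H := cfc Real.sqrt p

/-- `p^{-1/2}`, via continuous functional calculus. -/
def pinvsqrt (p : H →L[ℂ] H) : H →L[ℂ] H := cfc (fun t : ℝ => (Real.sqrt t)⁻¹) p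

/-- `log p`, via continuous functional calculus. -/
def plog (p : H →L[ℂ] H) : H →L[ℂ] H := cfc Real.log p

/-- The geodesic distance `d(p, q) = ‖log (p^{-1/2} q p^{-1/2})‖₂`. -/
def gdist (e : HilbertBasis ι ℂ H) (p q : H →L[ℂ] H) : ℝ :=
  hsNorm e (plog (pinvsqrt p * q * pinvsqrt p))

/-- The commutator `[A, B] = AB - BA`. -/
def brk (A B : H →L[ℂ] H) : H →L[ℂ] H := A * B - B * A

/-- The constant-speed geodesic `t ↦ p^{1/2} exp(t K) p^{1/2}`. -/
def geoCurve (p K : H →L[ℂ] H) (t : ℝ) : H →L[ℂ] H :=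
  psqrt p * NormedSpace.exp (t • K) * psqrt p

/-- The geodesic from `p` to `q`:
`t ↦ p^{1/2} exp(t log(p^{-1/2} q p^{-1/2})) p^{1/2}`. -/
def geodesic (p q : H →L[ℂ] H) (t : ℝ) : H →L[ℂ] H :=
  geoCurve p (plog (pinvsqrt p * q * pinvsqrt p)) t

/-- The image `exp E` of a set of operators under the exponential map. -/
def expSet (E : Set (H →L[ℂ] H)) : Set (H →L[ℂ] H) := NormedSpace.exp '' E

/-- The orthogonal complement of `E` inside `S₂(H)` for the Hilbert–Schmidt
inner product. -/
def hsPerp (e : HilbertBasis ι ℂ H) (E : Set (H →L[ℂ] H)) : Set (H →L[ℂ] H) :=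
  {Y | MemS2 e Y ∧ ∀ X ∈ E, hsInner e X Y = 0}

/-- `E` is closed in `S₂(H)` with respect to the Hilbert–Schmidt norm. -/
def IsHSClosed (e : HilbertBasis ι ℂ H) (E : Set (H →L[ℂ] H)) : Prop :=
  ∀ X : H →L[ℂ] H, MemS2 e X → (∀ ε > (0:ℝ), ∃ Y ∈ E, hsNorm e (X - Y) < ε) → X ∈ E

set_option linter.unusedSectionVars false


theorem hs_parseval (e : HilbertBasis ι ℂ H) (x : H) :
    ∑' i, (‖(inner ℂ (e i) x : ℂ)‖ₑ : ENNReal) ^ 2 = ‖x‖ₑ ^ 2 := by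
  have h := e.hasSum_inner_mul_inner x x
  have h2 : HasSum (fun i => ‖(inner ℂ (e i) x : ℂ)‖ ^ 2) (‖x‖ ^ 2) := by
    have h3 := Complex.hasSum_re h
    convert h3 using 1
    · ext i
      rw [← inner_conj_symm x, mul_comm, Complex.mul_conj, Complex.ofReal_re, Complex.normSq_eq_norm_sq]
    · have := inner_self_eq_norm_sq (𝕜 := ℂ) x
      exact this.symm
  have h4 : ∀ r : ℝ, 0 ≤ r → ENNReal.ofReal (r ^ 2) = ENNReal.ofReal r ^ 2 := fun r hr =>
    ENNReal.ofReal_pow hr 2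
  have := ENNReal.ofReal_tsum_of_nonneg (f := fun i => ‖(inner ℂ (e i) x : ℂ)‖ ^ 2)
    (fun i => sq_nonneg _) h2.summable
  rw [h2.tsum_eq] at this
  simp only [h4 _ (norm_nonneg _), ofReal_norm] at this
  exact this.symm

theorem hs_adj_enn (e : HilbertBasis ι ℂ H) (A : H →L[ℂ] H) :
    ∑' i, (‖A (e i)‖ₑ : ENNReal) ^ 2 = ∑' i, ‖(star A) (e i)‖ₑ ^ 2 := by
  simp only [← hs_parseval e]
  rw [ENNReal.tsum_comm]
  congr 1; ext i; congr 1; ext j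
  rw [ContinuousLinearMap.star_eq_adjoint, ContinuousLinearMap.adjoint_inner_right]
  rw [← inner_conj_symm, ← ofReal_norm, ← ofReal_norm, RCLike.norm_conj]

theorem isHS_iff_enn (e : HilbertBasis ι ℂ H) (A : H →L[ℂ] H) :
    IsHS e A ↔ ∑' i, (‖A (e i)‖ₑ : ENNReal) ^ 2 ≠ ⊤ := by
  unfold IsHS
  have : ∀ i, (‖A (e i)‖ₑ : ENNReal) ^ 2 = ENNReal.ofReal (‖A (e i)‖ ^ 2) := fun i => by
    rw [ENNReal.ofReal_pow (norm_nonneg _), ofReal_norm]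
  simp only [this]
  constructor
  · intro h
    exact h.tsum_ofReal_ne_top
  · intro h
    have := ENNReal.summable_toReal h
    simpa [ENNReal.toReal_ofReal, sq_nonneg] using this

theorem IsHS.adj {e : HilbertBasis ι ℂ H} {A : H →L[ℂ] H} (h : IsHS e A) : IsHS e (star A) := by
  rw [isHS_iff_enn, ← hs_adj_enn]
  exact (isHS_iff_enn e A).1 h

theorem hsNorm_star (e : HilbertBasis ι ℂ H) (A : H →L[ℂ] H) : hsNorm e (star A) = hsNorm e A := by
  unfold hsNorm
  congr 1
  have key : ∀ B : H →L[ℂ] H, ∑' i, ‖B (e i)‖ ^ 2 = (∑' i, (‖B (e i)‖ₑ : ENNReal) ^ 2).toReal := by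
    intro B
    rw [ENNReal.tsum_toReal_eq (fun i => by simp)]
    simp
  rw [key, key, ← hs_adj_enn]

theorem IsHS.add {e : HilbertBasis ι ℂ H} {A B : H →L[ℂ] H} (hA : IsHS e A) (hB : IsHS e B) :
    IsHS e (A + B) := by
  unfold IsHS at *
  refine Summable.of_nonneg_of_le (fun i => sq_nonneg _) (fun i => ?_) ((hA.mul_left 2).add (hB.mul_left 2))
  have := norm_add_le (A (e i)) (B (e i))
  have h0 := norm_nonneg (A (e i) + B (e i))
  simp only [add_apply]
  nlinarith [sq_nonneg (‖A (e i)‖ - ‖B (e i)‖)]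

theorem IsHS.mul_left {e : HilbertBasis ι ℂ H} {B : H →L[ℂ] H} (A : H →L[ℂ] H) (hB : IsHS e B) :
    IsHS e (A * B) := by
  unfold IsHS at *
  refine Summable.of_nonneg_of_le (fun i => sq_nonneg _) (fun i => ?_) (hB.mul_left (‖A‖ ^ 2))
  have := A.le_opNorm (B (e i))
  rw [← mul_pow]
  exact pow_le_pow_left₀ (norm_nonneg _) this 2

theorem IsHS.mul_right {e : HilbertBasis ι ℂ H} {B : H →L[ℂ] H} (hB : IsHS e B) (A : H →L[ℂ] H) :
    IsHS e (B * A) := by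
  have := (IsHS.mul_left (star A) hB.adj).adj
  simpa using this

theorem IsHS.zero (e : HilbertBasis ι ℂ H) : IsHS e (0 : H →L[ℂ] H) := by
  simp [IsHS, summable_zero]

theorem IsHS.smul {e : HilbertBasis ι ℂ H} {B : H →L[ℂ] H} (r : ℝ) (hB : IsHS e B) :
    IsHS e (r • B) := by
  have := IsHS.mul_left (r • (1 : H →L[ℂ] H)) hB
  simpa using this

/-- the submodule of HS operators -/
def HSsub (e : HilbertBasis ι ℂ H) : Submodule ℝ (H →L[ℂ] H) where
  carrier := {A | IsHS e A}
  add_mem' := IsHS.add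
  zero_mem' := IsHS.zero e
  smul_mem' := fun r _ h => IsHS.smul r h

/-- the space of HS operators -/
def HSp (e : HilbertBasis ι ℂ H) : Type _ := ↥(HSsub e)

instance (e : HilbertBasis ι ℂ H) : AddCommGroup (HSp e) :=
  inferInstanceAs (AddCommGroup ↥(HSsub e))
instance (e : HilbertBasis ι ℂ H) : Module ℝ (HSp e) :=
  inferInstanceAs (Module ℝ ↥(HSsub e))

/-- the underlying operator -/
def HSp.opl {e : HilbertBasis ι ℂ H} : HSp e →ₗ[ℝ] (H →L[ℂ] H) := (HSsub e).subtype

theorem HSp.opl_inj {e : HilbertBasis ι ℂ H} : Function.Injective (HSp.opl (e := e)) :=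
  Subtype.val_injective

/-- constructor -/
def HSp.mk {e : HilbertBasis ι ℂ H} (A : H →L[ℂ] H) (h : IsHS e A) : HSp e := ⟨A, h⟩

theorem HSp.opl_mk {e : HilbertBasis ι ℂ H} (A : H →L[ℂ] H) (h : IsHS e A) :
  HSp.opl (HSp.mk A h) = A := rfl

theorem HSp.isHS {e : HilbertBasis ι ℂ H} (A : HSp e) : IsHS e (HSp.opl A) := A.2

/-- embedding in l2 -/
def HSp.toLp {e : HilbertBasis ι ℂ H} : HSp e →ₗ[ℝ] lp (fun _ : ι => H) 2 where
  toFun A := ⟨fun i => HSp.opl A (e i), by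
    apply memℓp_gen
    have := A.isHS
    unfold IsHS at this
    simpa using this⟩
  map_add' A B := by
    apply Subtype.ext; funext i; change HSp.opl (A + B) (e i) = HSp.opl A (e i) + HSp.opl B (e i); rw [map_add]; rfl
  map_smul' r A := by
    apply Subtype.ext; funext i; change HSp.opl (r • A) (e i) = r • HSp.opl A (e i); rw [map_smul]; rfl

theorem HSp.toLp_apply {e : HilbertBasis ι ℂ H} (A : HSp e) (i : ι) :
  HSp.toLp A i = HSp.opl A (e i) := rfl

theorem HSp.ext_basis {e : HilbertBasis ι ℂ H} {A B : H →L[ℂ] H} (h : ∀ i, A (e i) = B (e i)) : A = B := by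
  apply ContinuousLinearMap.ext_on (s := Set.range e)
  · have := e.dense_span
    exact (Submodule.dense_iff_topologicalClosure_eq_top).2 this
  · rintro _ ⟨i, rfl⟩
    exact h i

theorem HSp.toLp_inj {e : HilbertBasis ι ℂ H} : Function.Injective (HSp.toLp (e := e)) := by
  intro A B h
  apply HSp.opl_inj
  apply HSp.ext_basis
  intro i
  rw [← HSp.toLp_apply, h, HSp.toLp_apply]

instance (e : HilbertBasis ι ℂ H) : NormedAddCommGroup (HSp e) :=
  NormedAddCommGroup.induced _ _ HSp.toLp HSp.toLp_inj

instance (e : HilbertBasis ι ℂ H) : NormedSpace ℝ (HSp e) :=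
  NormedSpace.induced ℝ _ _ HSp.toLp

theorem HSp.norm_toLp {e : HilbertBasis ι ℂ H} (A : HSp e) : ‖HSp.toLp A‖ = ‖A‖ := rfl

instance (e : HilbertBasis ι ℂ H) : InnerProductSpace ℝ (HSp e) where
  inner A B := (inner ℂ (HSp.toLp A) (HSp.toLp B) : ℂ).re
  norm_sq_eq_re_inner A := by
    rw [← HSp.norm_toLp]; exact norm_sq_eq_re_inner (𝕜 := ℂ) (HSp.toLp A)
  conj_inner_symm A B := by
    exact inner_re_symm (𝕜 := ℂ) _ _
  add_left A B C := by rw [map_add, inner_add_left]; simp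
  smul_left A B r := by
    have : HSp.toLp (r • A) = (r : ℂ) • HSp.toLp A := by
      rw [map_smul]; ext i; exact (Complex.coe_smul r (HSp.toLp A i)).symm
    rw [this, inner_smul_left]; simp

theorem HSp.inner_toLp {e : HilbertBasis ι ℂ H} (A B : HSp e) :
    inner ℝ A B = (inner ℂ (HSp.toLp A) (HSp.toLp B) : ℂ).re := rfl

theorem HSp.norm_eq {e : HilbertBasis ι ℂ H} (A : HSp e) : ‖A‖ = hsNorm e (HSp.opl A) := by
  rw [← HSp.norm_toLp, lp.norm_eq_tsum_rpow (by norm_num), hsNorm, Real.sqrt_eq_rpow]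
  simp [HSp.toLp_apply]

theorem HSp.norm_opl_le {e : HilbertBasis ι ℂ H} (A : HSp e) : ‖HSp.opl A‖ ≤ ‖A‖ := by
  rw [← norm_star, HSp.norm_eq]
  refine ContinuousLinearMap.opNorm_le_bound _ (Real.sqrt_nonneg _) fun x => ?_
  have h1 := e.hasSum_inner_mul_inner (star (HSp.opl A) x) (star (HSp.opl A) x)
  have h3 := Complex.hasSum_re h1
  have h4 : ‖star (HSp.opl A) x‖ ^ 2 ≤ (∑' i, ‖HSp.opl A (e i)‖ ^ 2) * ‖x‖ ^ 2 := by
    have := inner_self_eq_norm_sq (𝕜 := ℂ) (star (HSp.opl A) x)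
    rw [← this, ← tsum_mul_right]
    refine (h3.tsum_eq).symm.le.trans ?_
    refine Summable.tsum_le_tsum (fun i => ?_) h3.summable (Summable.mul_right _ A.isHS)
    rw [← inner_conj_symm, mul_comm, Complex.mul_conj, Complex.ofReal_re, Complex.normSq_eq_norm_sq,
      ← mul_pow]
    refine pow_le_pow_left₀ (norm_nonneg _) ?_ 2
    rw [ContinuousLinearMap.star_eq_adjoint, ContinuousLinearMap.adjoint_inner_right]
    exact norm_inner_le_norm _ _
  have h5 := Real.sqrt_le_sqrt h4
  rwa [Real.sqrt_sq (norm_nonneg _), Real.sqrt_mul' _ (sq_nonneg _), Real.sqrt_sq (norm_nonneg _)] at h5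

/-- the underlying operator, continuous version -/
def HSp.op {e : HilbertBasis ι ℂ H} : HSp e →L[ℝ] (H →L[ℂ] H) :=
  HSp.opl.mkContinuous 1 (fun A => by simpa using HSp.norm_opl_le A)

theorem HSp.op_eq {e : HilbertBasis ι ℂ H} (A : HSp e) : HSp.op A = HSp.opl A := rfl
theorem HSp.op_inj {e : HilbertBasis ι ℂ H} : Function.Injective (HSp.op (e := e)) := HSp.opl_inj
theorem HSp.op_mk {e : HilbertBasis ι ℂ H} (A : H →L[ℂ] H) (h : IsHS e A) :
  HSp.op (HSp.mk A h) = A := rfl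
theorem HSp.norm_op_le {e : HilbertBasis ι ℂ H} (A : HSp e) : ‖HSp.op A‖ ≤ ‖A‖ := HSp.norm_opl_le A
theorem HSp.norm_eq' {e : HilbertBasis ι ℂ H} (A : HSp e) : ‖A‖ = hsNorm e (HSp.op A) := HSp.norm_eq A
theorem HSp.norm_mk {e : HilbertBasis ι ℂ H} (A : H →L[ℂ] H) (h : IsHS e A) :
    ‖HSp.mk A h‖ = hsNorm e A := HSp.norm_eq _

instance (e : HilbertBasis ι ℂ H) : CompleteSpace (HSp e) := by
  apply Metric.complete_of_cauchySeq_tendsto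
  intro u hu
  let toLi : HSp e →ₗᵢ[ℝ] lp (fun _ : ι => H) 2 := ⟨HSp.toLp, fun A => HSp.norm_toLp A⟩
  have h1 : CauchySeq (fun n => toLi (u n)) := toLi.isometry.uniformContinuous.comp_cauchySeq hu
  have h2 : CauchySeq (fun n => HSp.op (u n)) := (HSp.op (e := e)).uniformContinuous.comp_cauchySeq hu
  obtain ⟨v, hv⟩ := cauchySeq_tendsto_of_complete h1
  obtain ⟨A, hA⟩ := cauchySeq_tendsto_of_complete h2
  have h3 : ∀ i, A (e i) = v i := by
    intro i
    have ha : Filter.Tendsto (fun n => HSp.op (u n) (e i)) Filter.atTop (nhds (A (e i))) :=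
      ((ContinuousLinearMap.apply ℂ H (e i)).continuous.tendsto A).comp hA
    have hb : Filter.Tendsto (fun n => HSp.op (u n) (e i)) Filter.atTop (nhds (v i)) := by
      rw [tendsto_iff_norm_sub_tendsto_zero] at hv ⊢
      refine squeeze_zero (fun _ => norm_nonneg _) (fun n => ?_) hv
      exact lp.norm_apply_le_norm (by norm_num) (toLi (u n) - v) i
    exact tendsto_nhds_unique ha hb
  have hHS : IsHS e A := by
    have := (memℓp_gen_iff (p := 2) (by norm_num)).1 v.2
    unfold IsHS
    simpa [h3] using this
  refine ⟨HSp.mk A hHS, ?_⟩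
  have h4 : toLi (HSp.mk A hHS) = v := by
    ext i
    exact h3 i
  rw [toLi.isometry.isEmbedding.tendsto_nhds_iff, h4]
  exact hv

/-- left multiplication -/
def HSp.mulL {e : HilbertBasis ι ℂ H} : (H →L[ℂ] H) →L[ℝ] HSp e →L[ℝ] HSp e :=
  LinearMap.mkContinuous₂ (LinearMap.mk₂ ℝ (fun A B => HSp.mk (A * HSp.op B) (IsHS.mul_left A B.isHS))
    (fun _ _ _ => HSp.op_inj (by simp [HSp.op_mk, add_mul]))
    (fun _ _ _ => HSp.op_inj (by simp [HSp.op_mk]))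
    (fun _ _ _ => HSp.op_inj (by simp [HSp.op_mk, mul_add]))
    (fun _ _ _ => HSp.op_inj (by simp [HSp.op_mk]))) 1 (fun A B => by
      rw [LinearMap.mk₂_apply, one_mul, HSp.norm_mk, HSp.norm_eq', hsNorm, hsNorm]
      rw [← Real.sqrt_sq (norm_nonneg A), ← Real.sqrt_mul (sq_nonneg _), ← tsum_mul_left]
      apply Real.sqrt_le_sqrt
      refine Summable.tsum_le_tsum (fun i => ?_) (IsHS.mul_left A B.isHS) (Summable.mul_left _ B.isHS)
      rw [← mul_pow]
      exact pow_le_pow_left₀ (norm_nonneg _) (A.le_opNorm _) 2)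

theorem HSp.op_mulL {e : HilbertBasis ι ℂ H} (A : H →L[ℂ] H) (B : HSp e) :
  HSp.op (HSp.mulL A B) = A * HSp.op B := rfl

theorem HSp.norm_mulL_le {e : HilbertBasis ι ℂ H} (A : H →L[ℂ] H) (B : HSp e) :
    ‖HSp.mulL A B‖ ≤ ‖A‖ * ‖B‖ := by
  have := (HSp.mulL (e := e)).le_opNorm₂ A B
  refine this.trans ?_
  have h1 : ‖HSp.mulL (e := e)‖ ≤ 1 := LinearMap.mkContinuous₂_norm_le _ zero_le_one _
  have : ‖HSp.mulL (e := e)‖ * ‖A‖ ≤ 1 * ‖A‖ := by gcongr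
  rw [one_mul] at this
  gcongr

/-- adjoint -/
def HSp.starL {e : HilbertBasis ι ℂ H} : HSp e →ₗᵢ[ℝ] HSp e where
  toFun A := HSp.mk (star (HSp.op A)) A.isHS.adj
  map_add' _ _ := HSp.op_inj (by simp [HSp.op_mk]; rfl)
  map_smul' _ _ := HSp.op_inj (by simp [HSp.op_mk]; rfl)
  norm_map' A := by
    exact (HSp.norm_mk _ _).trans ((hsNorm_star e _).trans (HSp.norm_eq' A).symm)

theorem HSp.op_starL {e : HilbertBasis ι ℂ H} (B : HSp e) :
  HSp.op (HSp.starL B) = star (HSp.op B) := rfl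

/-- right multiplication -/
def HSp.mulR {e : HilbertBasis ι ℂ H} : (H →L[ℂ] H) →L[ℝ] HSp e →L[ℝ] HSp e :=
  LinearMap.mkContinuous₂ (LinearMap.mk₂ ℝ (fun A B => HSp.mk (HSp.op B * A) (IsHS.mul_right B.isHS A))
    (fun _ _ _ => HSp.op_inj (by simp [HSp.op_mk, mul_add]; rfl))
    (fun _ _ _ => HSp.op_inj (by simp [HSp.op_mk]; rfl))
    (fun _ _ _ => HSp.op_inj (by simp [HSp.op_mk, add_mul]; rfl))
    (fun _ _ _ => HSp.op_inj (by simp [HSp.op_mk]; rfl))) 1 (fun A B => by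
      rw [LinearMap.mk₂_apply, one_mul]
      have : HSp.mk (HSp.op B * A) (IsHS.mul_right B.isHS A)
        = HSp.starL (HSp.mulL (star A) (HSp.starL B)) := HSp.op_inj (by
          rw [HSp.op_starL, HSp.op_mulL, HSp.op_starL, star_mul, star_star, star_star]; rfl)
      rw [this, LinearIsometry.norm_map]
      refine (HSp.norm_mulL_le _ _).trans ?_
      rw [LinearIsometry.norm_map, norm_star])

theorem HSp.op_mulR {e : HilbertBasis ι ℂ H} (A : H →L[ℂ] H) (B : HSp e) :
  HSp.op (HSp.mulR A B) = HSp.op B * A := rfl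

theorem HSp.mulR_eq {e : HilbertBasis ι ℂ H} (A : H →L[ℂ] H) (B : HSp e) :
    HSp.mulR A B = HSp.starL (HSp.mulL (star A) (HSp.starL B)) := HSp.op_inj (by
          rw [HSp.op_starL, HSp.op_mulL, HSp.op_starL, HSp.op_mulR]; simp)

theorem HSp.norm_mulR_le {e : HilbertBasis ι ℂ H} (A : H →L[ℂ] H) (B : HSp e) :
    ‖HSp.mulR A B‖ ≤ ‖B‖ * ‖A‖ := by
  rw [HSp.mulR_eq, LinearIsometry.norm_map]
  refine (HSp.norm_mulL_le _ _).trans ?_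
  rw [LinearIsometry.norm_map, norm_star, mul_comm]

theorem HSp.inner_mulL {e : HilbertBasis ι ℂ H} (A : H →L[ℂ] H) (B C : HSp e) :
    inner ℝ (HSp.mulL A B) C = inner ℝ B (HSp.mulL (star A) C) := by
  rw [HSp.inner_toLp, HSp.inner_toLp, lp.inner_eq_tsum, lp.inner_eq_tsum]
  congr 2; ext i
  simp only [HSp.toLp_apply]
  change (inner ℂ (A (HSp.op B (e i))) _ : ℂ) = (inner ℂ _ (star A (HSp.op C (e i))) : ℂ)
  rw [ContinuousLinearMap.star_eq_adjoint, ContinuousLinearMap.adjoint_inner_right]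
  rfl

theorem HSp.starL_starL {e : HilbertBasis ι ℂ H} (B : HSp e) : HSp.starL (HSp.starL B) = B :=
  HSp.op_inj (by rw [HSp.op_starL, HSp.op_starL, star_star])

theorem HSp.inner_mulR {e : HilbertBasis ι ℂ H} (A : H →L[ℂ] H) (B C : HSp e) :
    inner ℝ (HSp.mulR A B) C = inner ℝ B (HSp.mulR (star A) C) := by
  rw [HSp.mulR_eq, HSp.mulR_eq, ← HSp.starL.inner_map_map, HSp.starL_starL, HSp.inner_mulL,
    ← HSp.starL.inner_map_map (HSp.starL B), HSp.starL_starL]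


/-- `exp (t X)` -/
def ex (t : ℝ) (X : H →L[ℂ] H) : H →L[ℂ] H := NormedSpace.exp (t • X)

theorem ex_one (X : H →L[ℂ] H) : ex 1 X = NormedSpace.exp X := by simp [ex]

theorem ex_smul (s t : ℝ) (X : H →L[ℂ] H) : ex s (t • X) = ex (s * t) X := by
  simp [ex, smul_smul]

theorem ex_mul (s t : ℝ) (X : H →L[ℂ] H) : ex s X * ex t X = ex (s + t) X := by
  let := NormedAlgebra.restrictScalars ℚ ℂ (H →L[ℂ] H)
  unfold ex
  rw [add_smul, NormedSpace.exp_add_of_commute]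
  exact ((Commute.refl X).smul_left s).smul_right t

theorem ex_zero (X : H →L[ℂ] H) : ex 0 X = 1 := by
  simp [ex]

theorem ex_mul_neg (s : ℝ) (X : H →L[ℂ] H) : ex s X * ex (-s) X = 1 := by
  rw [ex_mul, add_neg_cancel, ex_zero]

theorem ex_neg_mul (s : ℝ) (X : H →L[ℂ] H) : ex (-s) X * ex s X = 1 := by
  rw [ex_mul, neg_add_cancel, ex_zero]

theorem ex_op_zero (s : ℝ) : ex s (0 : H →L[ℂ] H) = 1 := by
  simp [ex]

theorem ex_neg (s : ℝ) (X : H →L[ℂ] H) : ex s (-X) = ex (-s) X := by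
  simp [ex]

theorem star_ex (s : ℝ) {X : H →L[ℂ] H} (hX : IsSelfAdjoint X) : star (ex s X) = ex s X :=
  ((IsSelfAdjoint.smul (IsSelfAdjoint.all s) hX).exp : IsSelfAdjoint (ex s X))

theorem ex_deriv (X : H →L[ℂ] H) (s : ℝ) : HasDerivAt (fun s => ex s X) (ex s X * X) s :=
  hasDerivAt_exp_smul_const X s

theorem ex_deriv' (X : H →L[ℂ] H) (s : ℝ) : HasDerivAt (fun s => ex s X) (X * ex s X) s :=
  hasDerivAt_exp_smul_const' X s

theorem ex_cont (X : H →L[ℂ] H) : Continuous (fun s => ex s X) :=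
  continuous_iff_continuousAt.2 fun s => (ex_deriv X s).continuousAt

theorem norm_exp_le_aux (X : H →L[ℂ] H) : ‖NormedSpace.exp X‖ ≤ Real.exp ‖X‖ := by
  have h := NormedSpace.exp_series_hasSum_exp' (𝕂 := ℝ) X
  have h2 := NormedSpace.exp_series_hasSum_exp' (𝕂 := ℝ) ‖X‖
  rw [← Real.exp_eq_exp_ℝ] at h2
  rw [← h.tsum_eq]
  refine tsum_of_norm_bounded h2 fun n => ?_
  rw [norm_smul, smul_eq_mul, Real.norm_of_nonneg (by positivity)]
  gcongr
  induction n with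
  | zero => simp only [pow_zero]; exact ContinuousLinearMap.norm_id_le
  | succ n ih =>
    rw [pow_succ, pow_succ]
    exact (norm_mul_le _ _).trans (by gcongr)

theorem norm_ex_le (s : ℝ) (X : H →L[ℂ] H) : ‖ex s X‖ ≤ Real.exp (|s| * ‖X‖) := by
  refine (norm_exp_le_aux _).trans ?_
  rw [norm_smul, Real.norm_eq_abs]

theorem norm_ex_le' {s : ℝ} {X : H →L[ℂ] H} {R : ℝ} (hs : |s| ≤ 1) (hX : ‖X‖ ≤ R) :
    ‖ex s X‖ ≤ Real.exp R := by
  refine (norm_ex_le s X).trans ?_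
  apply Real.exp_le_exp.2
  nlinarith [norm_nonneg X, abs_nonneg s]

/-- `Z ↦ exp(-sA) Z exp(sB)` -/
def DK {e : HilbertBasis ι ℂ H} (A B : H →L[ℂ] H) (s : ℝ) : HSp e →L[ℝ] HSp e :=
  (HSp.mulL (ex (-s) A)).comp (HSp.mulR (ex s B))

theorem op_DK {e : HilbertBasis ι ℂ H} (A B : H →L[ℂ] H) (s : ℝ) (Z : HSp e) :
    HSp.op (DK A B s Z) = ex (-s) A * HSp.op Z * ex s B := by
  simp [DK, HSp.op_mulL, HSp.op_mulR, mul_assoc]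

theorem DK_cont {e : HilbertBasis ι ℂ H} (A B : H →L[ℂ] H) :
    Continuous (fun s => (DK A B s : HSp e →L[ℝ] HSp e)) := by
  unfold DK
  have h1 : Continuous fun s : ℝ => (HSp.mulL (ex (-s) A) : HSp e →L[ℝ] HSp e) :=
    HSp.mulL.continuous.comp ((ex_cont A).comp continuous_neg)
  have h2 : Continuous fun s : ℝ => (HSp.mulR (ex s B) : HSp e →L[ℝ] HSp e) :=
    HSp.mulR.continuous.comp (ex_cont B)
  exact h1.clm_comp h2

theorem DK_cont' {e : HilbertBasis ι ℂ H} (A B : H →L[ℂ] H) (Z : HSp e) :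
    Continuous (fun s => DK A B s Z) := (DK_cont A B).clm_apply continuous_const

theorem norm_DK_le {e : HilbertBasis ι ℂ H} (A B : H →L[ℂ] H) (s : ℝ) (Z : HSp e) :
    ‖DK A B s Z‖ ≤ Real.exp (|s| * (‖A‖ + ‖B‖)) * ‖Z‖ := by
  unfold DK
  refine (HSp.norm_mulL_le _ _).trans ?_
  have h1 := norm_ex_le (-s) A
  have h2 := norm_ex_le s B
  have h3 := HSp.norm_mulR_le (ex s B) Z
  rw [abs_neg] at h1
  rw [mul_add, Real.exp_add]
  calc ‖ex (-s) A‖ * ‖HSp.mulR (ex s B) Z‖ ≤ Real.exp (|s| * ‖A‖) * (‖Z‖ * Real.exp (|s| * ‖B‖)) := by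
        gcongr
        exact h3.trans (by gcongr)
    _ = _ := by ring

theorem DK_DK {e : HilbertBasis ι ℂ H} (A B : H →L[ℂ] H) (s t : ℝ) (Z : HSp e) :
    DK A B s (DK A B t Z) = DK A B (s + t) Z := by
  apply HSp.op_inj
  rw [op_DK, op_DK, op_DK]
  have h1 : ex (-(s + t)) A = ex (-s) A * ex (-t) A := by rw [ex_mul]; congr 1; ring
  have h2 : ex (s + t) B = ex t B * ex s B := by rw [ex_mul]; congr 1; ring
  rw [h1, h2]
  simp only [mul_assoc]

theorem DK_zero {e : HilbertBasis ι ℂ H} (A B : H →L[ℂ] H) (Z : HSp e) :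
    DK A B 0 Z = Z := by
  apply HSp.op_inj
  rw [op_DK]; simp [ex_zero]

theorem DK_inner {e : HilbertBasis ι ℂ H} {A B : H →L[ℂ] H} (hA : IsSelfAdjoint A)
    (hB : IsSelfAdjoint B) (s : ℝ) (Z W : HSp e) :
    inner ℝ (DK A B s Z) W = inner ℝ Z (DK A B s W) := by
  unfold DK
  rw [ContinuousLinearMap.comp_apply, HSp.inner_mulL, HSp.inner_mulR, star_ex _ hA, star_ex _ hB]
  congr 1

/-- Duhamel integral -/
def dI {e : HilbertBasis ι ℂ H} (A B : H →L[ℂ] H) (Z : HSp e) (a b : ℝ) : HSp e :=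
  ∫ s in a..b, DK A B s Z

theorem op_dI {e : HilbertBasis ι ℂ H} {A B : H →L[ℂ] H} {Z : HSp e} (h : HSp.op Z = B - A) (a b : ℝ) :
    HSp.op (dI A B Z a b) = ex (-b) A * ex b B - ex (-a) A * ex a B := by
  unfold dI
  rw [← ContinuousLinearMap.intervalIntegral_comp_comm HSp.op
    ((DK_cont' A B Z).intervalIntegrable _ _)]
  refine intervalIntegral.integral_eq_sub_of_hasDerivAt (f := fun s => ex (-s) A * ex s B) ?_
    ((HSp.op.continuous.comp (DK_cont' A B Z)).intervalIntegrable _ _)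
  intro s _
  have h1 : HasDerivAt (fun s => ex (-s) A) (-(ex (-s) A * A)) s := by
    have := (ex_deriv A (-s)).scomp s (hasDerivAt_neg s)
    simpa [Function.comp_def] using this
  have h2 := h1.mul (ex_deriv' B s)
  have h3 : HSp.op (DK A B s Z) = -(ex (-s) A * A) * ex s B + ex (-s) A * (B * ex s B) := by
    rw [op_DK, h]
    noncomm_ring
  rw [h3]
  exact h2

theorem norm_dI_le {e : HilbertBasis ι ℂ H} (A B : H →L[ℂ] H) (Z : HSp e) {a b δ : ℝ}
    (ha : |a| ≤ δ) (hb : |b| ≤ δ) :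
    ‖dI A B Z a b‖ ≤ Real.exp (δ * (‖A‖ + ‖B‖)) * ‖Z‖ * |b - a| := by
  refine intervalIntegral.norm_integral_le_of_norm_le_const fun s hs => ?_
  refine (norm_DK_le A B s Z).trans ?_
  have : |s| ≤ δ := by
    rw [Set.mem_uIoc] at hs
    rw [abs_le] at *
    rcases hs with hs | hs <;> constructor <;> linarith
  gcongr

theorem DK_pair {e : HilbertBasis ι ℂ H} {A B : H →L[ℂ] H} (hA : IsSelfAdjoint A)
    (hB : IsSelfAdjoint B) (s : ℝ) (Z : HSp e) :
    2 * ‖Z‖ ^ 2 ≤ inner ℝ (DK A B s Z) Z + inner ℝ (DK A B (-s) Z) Z := by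
  have h1 : ∀ s, inner ℝ (DK A B s Z) Z = ‖DK A B (s/2) Z‖ ^ 2 := by
    intro s
    rw [← real_inner_self_eq_norm_sq, ← DK_inner hA hB, DK_DK, add_halves]
  have h2 : inner ℝ (DK A B (s/2) Z) (DK A B (-s/2) Z) = ‖Z‖ ^ 2 := by
    rw [← DK_inner hA hB, DK_DK, ← real_inner_self_eq_norm_sq]
    have : -s/2 + s/2 = 0 := by ring
    rw [this, DK_zero]
  have h3 := real_inner_self_nonneg (x := DK A B (s/2) Z - DK A B (-s/2) Z)
  rw [real_inner_sub_sub_self, h2, real_inner_self_eq_norm_sq, real_inner_self_eq_norm_sq] at h3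
  rw [h1, h1]
  linarith

theorem inner_dI_ge {e : HilbertBasis ι ℂ H} {A B : H →L[ℂ] H} (hA : IsSelfAdjoint A)
    (hB : IsSelfAdjoint B) (Z : HSp e) :
    ‖Z‖ ^ 2 ≤ inner ℝ (dI A B Z (-(1/2)) (1/2)) Z := by
  have hc : Continuous fun s => inner ℝ (DK A B s Z) Z := (DK_cont' A B Z).inner continuous_const
  have hc' : Continuous fun s => inner ℝ (DK A B (-s) Z) Z := hc.comp continuous_neg
  have h1 : inner ℝ (dI A B Z (-(1/2)) (1/2)) Z = ∫ s in (-(1/2))..(1/2), inner ℝ (DK A B s Z) Z := by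
    unfold dI
    have := ContinuousLinearMap.intervalIntegral_comp_comm (innerSL ℝ Z)
      ((DK_cont' A B Z).intervalIntegrable (μ := MeasureTheory.volume) (-(1/2)) (1/2))
    simp only [innerSL_apply_apply] at this
    rw [real_inner_comm, ← this]
    simp only [real_inner_comm]
  have h2 : (∫ s in (-(1/2))..(1/2), inner ℝ (DK A B (-s) Z) Z) =
      ∫ s in (-(1/2))..(1/2), inner ℝ (DK A B s Z) Z := by
    have := intervalIntegral.integral_comp_neg (a := -(1/2)) (b := 1/2)
      (fun s : ℝ => inner ℝ (DK A B s Z) Z)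
    rw [neg_neg] at this
    exact this
  have h3 : (∫ s in (-(1/2) : ℝ)..(1/2), 2 * ‖Z‖ ^ 2) ≤
      ∫ s in (-(1/2))..(1/2), (inner ℝ (DK A B s Z) Z + inner ℝ (DK A B (-s) Z) Z) := by
    apply intervalIntegral.integral_mono (by norm_num)
    · exact continuous_const.intervalIntegrable _ _
    · exact (hc.add (hc.comp continuous_neg)).intervalIntegrable _ _
    · intro s; exact DK_pair hA hB s Z
  rw [intervalIntegral.integral_add (hc.intervalIntegrable _ _)
    (hc'.intervalIntegrable _ _), h2, intervalIntegral.integral_const, ← h1] at h3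
  norm_num at h3
  linarith

theorem norm_le_dI {e : HilbertBasis ι ℂ H} {A B : H →L[ℂ] H} (hA : IsSelfAdjoint A)
    (hB : IsSelfAdjoint B) (Z : HSp e) : ‖Z‖ ≤ ‖dI A B Z (-(1/2)) (1/2)‖ := by
  have h1 := inner_dI_ge hA hB Z
  have h2 := real_inner_le_norm (dI A B Z (-(1/2)) (1/2)) Z
  rcases (norm_nonneg Z).eq_or_lt with h | h
  · rw [← h]; exact norm_nonneg _
  · nlinarith


theorem plog_exp {X : H →L[ℂ] H} (hX : IsSelfAdjoint X) : plog (ex 1 X) = X := by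
  rw [ex_one]
  exact CFC.log_exp X hX

theorem pinvsqrt_exp {X : H →L[ℂ] H} (hX : IsSelfAdjoint X) : pinvsqrt (ex 1 X) = ex (-(1/2)) X := by
  have h2 : IsSelfAdjoint ((-(1/2) : ℝ) • X) := IsSelfAdjoint.smul (IsSelfAdjoint.all _) hX
  rw [ex_one, pinvsqrt, ex, ← CFC.real_exp_eq_normedSpace_exp hX, ← CFC.real_exp_eq_normedSpace_exp h2]
  rw [← cfc_comp_smul (-(1/2) : ℝ) Real.exp X Real.continuous_exp.continuousOn hX]
  rw [← cfc_comp' (fun t : ℝ => (Real.sqrt t)⁻¹) Real.exp X ?_ Real.continuous_exp.continuousOn hX]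
  · congr 1
    funext x
    rw [← Real.exp_half, ← Real.exp_neg]
    simp; ring
  · apply ContinuousOn.inv₀ Real.continuous_sqrt.continuousOn
    rintro _ ⟨y, _, rfl⟩
    exact (Real.sqrt_pos.2 (Real.exp_pos y)).ne'

theorem gdist_nonneg (e : HilbertBasis ι ℂ H) (p q : H →L[ℂ] H) : 0 ≤ gdist e p q := Real.sqrt_nonneg _

theorem MemP.pos {e : HilbertBasis ι ℂ H} {p : H →L[ℂ] H} (hp : MemP e p) : IsStrictlyPositive p := by
  rw [IsStrictlyPositive.iff_of_unital]
  refine ⟨?_, hp.2.1⟩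
  rw [ContinuousLinearMap.nonneg_iff_isPositive]
  exact ⟨hp.1.isSymmetric, hp.2.2.1⟩

theorem MemP.exists_log {e : HilbertBasis ι ℂ H} {p : H →L[ℂ] H} (hp : MemP e p) :
    ∃ X, MemS2 e X ∧ ex 1 X = p := by
  refine ⟨plog p, ⟨IsSelfAdjoint.log, ?_⟩, ?_⟩
  · have hs : ∀ x ∈ spectrum ℝ p, 0 < x :=
      ((StarOrderedRing.isStrictlyPositive_iff_spectrum_pos (R := ℝ) p hp.1).1 hp.pos)
    have h1 : plog p = cfc (fun t : ℝ => dslope Real.log 1 t * (t - 1)) p := by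
      unfold plog
      congr 1
      funext t
      have := sub_smul_dslope Real.log 1 t
      rw [Real.log_one, sub_zero, smul_eq_mul] at this
      rw [← this, mul_comm]
    have hc : ContinuousOn (dslope Real.log 1) (spectrum ℝ p) := by
      have : ContinuousOn (dslope Real.log 1) (Set.Ioi 0) := by
        rw [continuousOn_dslope (Ioi_mem_nhds one_pos)]
        exact ⟨Real.continuousOn_log.mono (fun x hx => ne_of_gt hx),
          Real.differentiableAt_log one_ne_zero⟩
      exact this.mono hs
    rw [h1, cfc_mul _ _ p hc (by fun_prop)]
    apply IsHS.mul_left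
    have : cfc (fun t : ℝ => t - 1) p = p - 1 := by
      rw [cfc_sub (fun t : ℝ => t) (fun _ => (1:ℝ)) p, cfc_id' ℝ p hp.1, cfc_const_one ℝ p hp.1]
    rw [this]
    exact hp.2.2.2
  · rw [ex_one]
    exact CFC.exp_log p hp.pos

theorem isUnit_ex (s : ℝ) (X : H →L[ℂ] H) : IsUnit (ex s X) :=
  ⟨⟨ex s X, ex (-s) X, ex_mul_neg s X, ex_neg_mul s X⟩, rfl⟩

theorem isHS_ex_sub_one {e : HilbertBasis ι ℂ H} (s : ℝ) {X : H →L[ℂ] H} (hX : IsHS e X) :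
    IsHS e (ex s X - 1) := by
  have h := op_dI (A := 0) (B := X) (Z := HSp.mk X hX) (by simp [HSp.op_mk]) 0 s
  rw [ex_op_zero, ex_op_zero, ex_zero, one_mul, one_mul] at h
  rw [← h]
  exact HSp.isHS _

theorem memP_exp {e : HilbertBasis ι ℂ H} {X : H →L[ℂ] H} (hX : MemS2 e X) : MemP e (ex 1 X) := by
  refine ⟨star_ex 1 hX.1, isUnit_ex 1 X, fun x => ?_, isHS_ex_sub_one 1 hX.2⟩
  have h := hX.1.exp_nonneg
  rw [ContinuousLinearMap.nonneg_iff_isPositive] at h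
  rw [ex_one]
  exact h.2 x

theorem memP_conj {e : HilbertBasis ι ℂ H} {A p : H →L[ℂ] H} (hA : MemS2 e A) (t : ℝ) (hp : MemP e p) :
    MemP e (ex t A * p * ex t A) := by
  have hs := star_ex t hA.1
  refine ⟨?_, ((isUnit_ex t A).mul hp.2.1).mul (isUnit_ex t A), fun x => ?_, ?_⟩
  · rw [isSelfAdjoint_iff]; simp only [star_mul, hs, hp.1.star_eq, mul_assoc]
  · have := hp.2.2.1 (ex t A x)
    have h2 : inner ℂ ((ex t A * p * ex t A) x) x = inner ℂ (p (ex t A x)) (ex t A x) := by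
      conv_rhs => rw [← hs]
      rw [ContinuousLinearMap.star_eq_adjoint, ContinuousLinearMap.adjoint_inner_right,
        ← ContinuousLinearMap.star_eq_adjoint, hs]
      rfl
    rw [h2]; exact this
  · have h1 := isHS_ex_sub_one (e := e) t hA.2
    have h2 : ex t A * p * ex t A - 1 = ex t A * (p - 1) * ex t A + (ex t A - 1) * ex t A + (ex t A - 1) := by
      noncomm_ring
    rw [h2]
    exact (((hp.2.2.2.mul_left _).mul_right _).add (h1.mul_right _)).add h1

theorem hsNorm_mul_left_unit (e : HilbertBasis ι ℂ H) {u : H →L[ℂ] H} (hu : star u * u = 1) (A : H →L[ℂ] H) :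
    hsNorm e (u * A) = hsNorm e A := by
  unfold hsNorm
  have : ∀ x, ‖u x‖ = ‖x‖ := by
    rw [ContinuousLinearMap.star_eq_adjoint] at hu
    exact (ContinuousLinearMap.norm_map_iff_adjoint_comp_self u).2 hu
  simp [this]

theorem hsNorm_mul_right_unit (e : HilbertBasis ι ℂ H) {u : H →L[ℂ] H} (hu : u * star u = 1) (A : H →L[ℂ] H) :
    hsNorm e (A * u) = hsNorm e A := by
  rw [← hsNorm_star, star_mul, hsNorm_mul_left_unit e (by simpa using hu), hsNorm_star]

/-- key characterization of the distance -/
theorem gdist_eq {e : HilbertBasis ι ℂ H} {X W g q : H →L[ℂ] H} (hX : IsSelfAdjoint X) (hW : IsSelfAdjoint W)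
    (hg : IsUnit g) (h1 : g * ex 1 X * star g = 1) (h2 : g * q * star g = ex 1 W) :
    gdist e (ex 1 X) q = hsNorm e W := by
  have hsx := star_ex (1/2) hX
  obtain ⟨u, hu⟩ : ∃ u, u = g * ex (1/2) X := ⟨_, rfl⟩
  have hh : ex 1 X = ex (1/2) X * ex (1/2) X := by rw [ex_mul]; norm_num
  have huu : u * star u = 1 := by
    rw [hu, star_mul, hsx, ← h1, hh]; noncomm_ring
  have hun : IsUnit u := by rw [hu]; exact hg.mul (isUnit_ex _ _)
  have huu' : star u * u = 1 := by
    obtain ⟨v, hv⟩ := hun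
    have : star u = ↑v⁻¹ := by
      rw [← hv] at huu ⊢
      exact (Units.inv_eq_of_mul_eq_one_right huu).symm
    rw [this, ← hv]; simp
  have hgu : g = u * ex (-(1/2)) X := by
    rw [hu, mul_assoc, ex_mul_neg, mul_one]
  have hgs : star g = ex (-(1/2)) X * star u := by
    rw [hgu, star_mul, star_ex _ hX]
  have hr : ex (-(1/2)) X * q * ex (-(1/2)) X = star u * ex 1 W * u := by
    rw [← h2, hgs, hgu]
    have : star u * (u * ex (-(1/2)) X * q * (ex (-(1/2)) X * star u)) * u =
      (star u * u) * (ex (-(1/2)) X * q * ex (-(1/2)) X) * (star u * u) := by noncomm_ring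
    rw [this, huu']; simp
  let U : (H →L[ℂ] H)ˣ := ⟨u, star u, huu, huu'⟩
  have hr2 : star u * ex 1 W * u = ex 1 (star u * W * u) := by
    rw [ex_one, ex_one]
    let := NormedAlgebra.restrictScalars ℚ ℂ (H →L[ℂ] H)
    exact (NormedSpace.exp_units_conj' U W).symm
  have hsa : IsSelfAdjoint (star u * W * u) := by
    rw [isSelfAdjoint_iff]; simp [mul_assoc, hW.star_eq]
  unfold gdist
  rw [pinvsqrt_exp hX, hr, hr2, plog_exp hsa, hsNorm_mul_right_unit e huu,
    hsNorm_mul_left_unit e (by simpa using huu)]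

theorem exists_W {e : HilbertBasis ι ℂ H} {X q : H →L[ℂ] H} (hX : MemS2 e X) (hq : MemP e q) :
    ∃ W, MemS2 e W ∧ ex 1 W = ex (-(1/2)) X * q * ex (-(1/2)) X :=
  (memP_conj hX (-(1/2)) hq).exists_log

theorem ex_conj_one {X : H →L[ℂ] H} (hX : IsSelfAdjoint X) :
    ex (-(1/2)) X * ex 1 X * star (ex (-(1/2)) X) = 1 := by
  rw [star_ex _ hX, ex_mul, ex_mul, ← ex_zero X]; norm_num

theorem gdist_eq' {e : HilbertBasis ι ℂ H} {X q W : H →L[ℂ] H} (hX : IsSelfAdjoint X) (hW : IsSelfAdjoint W)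
    (h : ex 1 W = ex (-(1/2)) X * q * ex (-(1/2)) X) : gdist e (ex 1 X) q = hsNorm e W :=
  gdist_eq hX hW (isUnit_ex (-(1/2)) X) (ex_conj_one hX) (by rw [h, star_ex _ hX])

/-- congruence invariance -/
theorem gdist_conj {e : HilbertBasis ι ℂ H} {A p q : H →L[ℂ] H} (hA : MemS2 e A) (t : ℝ) (hp : MemP e p)
    (hq : MemP e q) : gdist e (ex t A * p * ex t A) (ex t A * q * ex t A) = gdist e p q := by
  obtain ⟨X, hX, rfl⟩ := hp.exists_log
  obtain ⟨W, hW, hWe⟩ := exists_W hX hq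
  obtain ⟨X', hX', hX'e⟩ := (memP_conj hA t hp).exists_log
  rw [gdist_eq' hX.1 hW.1 hWe, ← hX'e]
  have hs1 := star_ex (-t) hA.1
  have hs2 := star_ex (-(1/2)) hX.1
  have c : ∀ r, ex (-(1/2)) X * ex (-t) A * (ex t A * r * ex t A) * (ex (-t) A * ex (-(1/2)) X) =
      ex (-(1/2)) X * r * ex (-(1/2)) X := by
    intro r
    have : ex (-(1/2)) X * ex (-t) A * (ex t A * r * ex t A) * (ex (-t) A * ex (-(1/2)) X) =
      ex (-(1/2)) X * (ex (-t) A * ex t A) * r * (ex t A * ex (-t) A) * ex (-(1/2)) X := by noncomm_ring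
    rw [this, ex_mul_neg, ex_neg_mul]; simp
  refine gdist_eq (g := ex (-(1/2)) X * ex (-t) A) hX'.1 hW.1 ((isUnit_ex _ _).mul (isUnit_ex _ _)) ?_ ?_
  · rw [hX'e, star_mul, hs1, hs2, c]
    have := ex_conj_one hX.1
    rwa [hs2] at this
  · rw [star_mul, hs1, hs2, c, hWe]

theorem gdist_one {e : HilbertBasis ι ℂ H} {W : H →L[ℂ] H} (hW : IsSelfAdjoint W) :
    gdist e 1 (ex 1 W) = hsNorm e W := by
  have h := gdist_eq' (e := e) (X := 0) (q := ex 1 W) (W := W) (IsSelfAdjoint.zero _) hW (by simp [ex_op_zero])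
  rwa [ex_op_zero] at h

theorem memS2_zero (e : HilbertBasis ι ℂ H) : MemS2 e (0 : H →L[ℂ] H) := ⟨IsSelfAdjoint.zero _, IsHS.zero e⟩

theorem memP_one (e : HilbertBasis ι ℂ H) : MemP e (1 : H →L[ℂ] H) := by
  have := memP_exp (memS2_zero e)
  rwa [ex_op_zero] at this

theorem MemS2.smul {e : HilbertBasis ι ℂ H} {X : H →L[ℂ] H} (hX : MemS2 e X) (t : ℝ) : MemS2 e (t • X) :=
  ⟨IsSelfAdjoint.smul (IsSelfAdjoint.all _) hX.1, hX.2.smul t⟩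

theorem MemS2.add {e : HilbertBasis ι ℂ H} {X Y : H →L[ℂ] H} (hX : MemS2 e X) (hY : MemS2 e Y) : MemS2 e (X + Y) :=
  ⟨hX.1.add hY.1, hX.2.add hY.2⟩

theorem MemS2.neg {e : HilbertBasis ι ℂ H} {X : H →L[ℂ] H} (hX : MemS2 e X) : MemS2 e (-X) := by
  have := hX.smul (-1)
  simpa using this

theorem MemS2.sub {e : HilbertBasis ι ℂ H} {X Y : H →L[ℂ] H} (hX : MemS2 e X) (hY : MemS2 e Y) : MemS2 e (X - Y) := by
  rw [sub_eq_add_neg]; exact hX.add hY.neg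

theorem memP_ex {e : HilbertBasis ι ℂ H} {X : H →L[ℂ] H} (hX : MemS2 e X) (t : ℝ) : MemP e (ex t X) := by
  have := memP_exp (hX.smul t)
  rwa [ex_smul, one_mul] at this

theorem hsNorm_neg (e : HilbertBasis ι ℂ H) (A : H →L[ℂ] H) : hsNorm e (-A) = hsNorm e A := by
  simp [hsNorm]

theorem hsNorm_smul (e : HilbertBasis ι ℂ H) (t : ℝ) {A : H →L[ℂ] H} (hA : IsHS e A) :
    hsNorm e (t • A) = |t| * hsNorm e A := by
  rw [← HSp.norm_mk A hA, ← HSp.norm_mk _ (hA.smul t)]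
  have : HSp.mk (t • A) (hA.smul t) = t • HSp.mk A hA := rfl
  rw [this, norm_smul, Real.norm_eq_abs]

theorem gdist_comm {e : HilbertBasis ι ℂ H} {p q : H →L[ℂ] H} (hp : MemP e p) (hq : MemP e q) :
    gdist e p q = gdist e q p := by
  obtain ⟨X, hX, rfl⟩ := hp.exists_log
  obtain ⟨Y, hY, rfl⟩ := hq.exists_log
  obtain ⟨W, hW, hWe⟩ := exists_W hX hq
  rw [gdist_eq' hX.1 hW.1 hWe]
  have hs1 := star_ex (-(1/2)) hW.1
  have hs2 := star_ex (-(1/2)) hX.1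
  rw [← hsNorm_neg]
  symm
  have c : ∀ r, ex (-(1/2)) W * ex (-(1/2)) X * r * (ex (-(1/2)) X * ex (-(1/2)) W) =
    ex (-(1/2)) W * (ex (-(1/2)) X * r * ex (-(1/2)) X) * ex (-(1/2)) W := fun r => by noncomm_ring
  refine gdist_eq (g := ex (-(1/2)) W * ex (-(1/2)) X) hY.1 hW.1.neg ((isUnit_ex _ _).mul (isUnit_ex _ _)) ?_ ?_
  · rw [star_mul, hs1, hs2, c, ← hWe]
    have := ex_conj_one hW.1
    rwa [hs1] at this
  · have := ex_conj_one hX.1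
    rw [hs2] at this
    rw [star_mul, hs1, hs2, c, this, mul_one, ex_mul, ex_neg]; norm_num


theorem isHS_sub {e : HilbertBasis ι ℂ H} {A B : H →L[ℂ] H} (hA : IsHS e A) (hB : IsHS e B) : IsHS e (A - B) := by
  have := hA.add (hB.smul (-1))
  simpa [sub_eq_add_neg] using this

theorem norm_sub_le_sinh {e : HilbertBasis ι ℂ H} {X Y : H →L[ℂ] H} (hX : IsSelfAdjoint X)
    (hY : IsSelfAdjoint Y) (h : IsHS e (Y - X)) :
    hsNorm e (Y - X) ≤ hsNorm e (ex (-(1/2)) X * ex (1/2) Y - ex (1/2) X * ex (-(1/2)) Y) := by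
  have h1 := norm_le_dI hX hY (HSp.mk (Y - X) h)
  have h2 := op_dI (A := X) (B := Y) (Z := HSp.mk (Y - X) h) rfl (-(1/2)) (1/2)
  rw [neg_neg] at h2
  rwa [HSp.norm_mk, HSp.norm_eq', h2] at h1

theorem emi_local {e : HilbertBasis ι ℂ H} {X Y W g : H →L[ℂ] H} (hX : IsSelfAdjoint X)
    (hY : IsSelfAdjoint Y) (hW : IsSelfAdjoint W) (h : IsHS e (Y - X)) (hg : IsUnit g)
    (h1 : g * ex 1 X * star g = 1) (h2 : g * ex 1 Y * star g = ex 1 W) :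
    hsNorm e (Y - X) ≤ hsNorm e (ex (1/2) W - ex (-(1/2)) W) := by
  refine (norm_sub_le_sinh hX hY h).trans (le_of_eq ?_)
  have hgs : IsUnit (star g) := hg.star
  have k1 : star g * g = ex (-1) X := by
    have : (star g * g * ex 1 X) = 1 := by
      apply hgs.mul_right_cancel
      calc star g * g * ex 1 X * star g = star g * (g * ex 1 X * star g) := by noncomm_ring
        _ = _ := by rw [h1, one_mul, mul_one]
    calc star g * g = star g * g * (ex 1 X * ex (-1) X) := by rw [ex_mul_neg, mul_one]
      _ = star g * g * ex 1 X * ex (-1) X := by noncomm_ring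
      _ = _ := by rw [this, one_mul]
  have k2 : star g * ex (-1) W * g = ex (-1) Y := by
    have : (star g * ex (-1) W * g * ex 1 Y) = 1 := by
      apply hgs.mul_right_cancel
      calc star g * ex (-1) W * g * ex 1 Y * star g = star g * (ex (-1) W * (g * ex 1 Y * star g)) := by noncomm_ring
        _ = _ := by rw [h2, ex_neg_mul, one_mul, mul_one]
    calc star g * ex (-1) W * g = star g * ex (-1) W * g * (ex 1 Y * ex (-1) Y) := by rw [ex_mul_neg, mul_one]
      _ = star g * ex (-1) W * g * ex 1 Y * ex (-1) Y := by noncomm_ring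
      _ = _ := by rw [this, one_mul]
  obtain ⟨u, hu⟩ : ∃ u, u = ex (1/2) X * star g := ⟨_, rfl⟩
  obtain ⟨v, hv⟩ : ∃ v, v = ex (-(1/2)) W * g * ex (1/2) Y := ⟨_, rfl⟩
  have huu : star u * u = 1 := by
    rw [hu, star_mul, star_ex _ hX, star_star, ← h1]
    calc g * ex (1/2) X * (ex (1/2) X * star g) = g * (ex (1/2) X * ex (1/2) X) * star g := by noncomm_ring
      _ = _ := by rw [ex_mul]; norm_num
  have hvv : v * star v = 1 := by
    rw [hv, star_mul, star_mul, star_ex _ hW, star_ex _ hY]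
    calc ex (-(1/2)) W * g * ex (1/2) Y * (ex (1/2) Y * (star g * ex (-(1/2)) W))
        = ex (-(1/2)) W * (g * (ex (1/2) Y * ex (1/2) Y) * star g) * ex (-(1/2)) W := by noncomm_ring
      _ = _ := by
        rw [ex_mul, add_halves, h2, ex_mul, ex_mul, ← ex_zero W]; norm_num
  have e1 : ex (-(1/2)) X * ex (1/2) Y = u * ex (1/2) W * v := by
    rw [hu, hv]
    calc ex (-(1/2)) X * ex (1/2) Y = ex (1/2) X * (star g * g) * ex (1/2) Y := by
          rw [k1, ex_mul]; norm_num
      _ = ex (1/2) X * star g * (ex (1/2) W * ex (-(1/2)) W) * g * ex (1/2) Y := by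
          rw [ex_mul_neg]; noncomm_ring
      _ = _ := by noncomm_ring
  have e2 : ex (1/2) X * ex (-(1/2)) Y = u * ex (-(1/2)) W * v := by
    rw [hu, hv]
    calc ex (1/2) X * ex (-(1/2)) Y = ex (1/2) X * (ex (-1) Y * ex (1/2) Y) := by
          rw [ex_mul]; norm_num
      _ = ex (1/2) X * star g * ex (-1) W * g * ex (1/2) Y := by
          rw [← k2]; noncomm_ring
      _ = ex (1/2) X * star g * (ex (-(1/2)) W * ex (-(1/2)) W) * g * ex (1/2) Y := by
          rw [ex_mul]; norm_num
      _ = _ := by noncomm_ring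
  have e3 : u * ex (1/2) W * v - u * ex (-(1/2)) W * v = u * (ex (1/2) W - ex (-(1/2)) W) * v := by
    noncomm_ring
  rw [e1, e2, e3, hsNorm_mul_right_unit e hvv, hsNorm_mul_left_unit e huu]

theorem sinh_le {e : HilbertBasis ι ℂ H} {W : H →L[ℂ] H} (hW : IsHS e W) {s : ℝ} (hs : 0 ≤ s) :
    hsNorm e (ex (s/2) W - ex (-(s/2)) W) ≤ Real.exp (s/2 * ‖W‖) * hsNorm e W * s := by
  have h2 := op_dI (A := 0) (B := W) (Z := HSp.mk W hW) (by simp [HSp.op_mk]) (-(s/2)) (s/2)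
  rw [ex_op_zero, ex_op_zero, one_mul, one_mul] at h2
  have h3 := norm_dI_le 0 W (HSp.mk W hW) (a := -(s/2)) (b := s/2) (δ := s/2)
    (by rw [abs_neg, abs_of_nonneg (by linarith)]) (by rw [abs_of_nonneg (by linarith)])
  rw [HSp.norm_eq', h2, norm_zero, zero_add, HSp.norm_mk, sub_neg_eq_add, add_halves,
    abs_of_nonneg hs] at h3
  exact h3

theorem ex_inj {X Y : H →L[ℂ] H} (hX : IsSelfAdjoint X) (hY : IsSelfAdjoint Y) (h : ex 1 X = ex 1 Y) :
    X = Y := by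
  rw [← plog_exp hX, h, plog_exp hY]

theorem conj_ex {X r : H →L[ℂ] H} (t : ℝ) : ex (-t) X * (ex t X * r * ex t X) * ex (-t) X = r := by
  calc _ = (ex (-t) X * ex t X) * r * (ex t X * ex (-t) X) := by noncomm_ring
    _ = r := by rw [ex_neg_mul, ex_mul_neg]; simp

theorem conj_ex' {X r : H →L[ℂ] H} (t : ℝ) : ex t X * (ex (-t) X * r * ex (-t) X) * ex t X = r := by
  calc _ = (ex t X * ex (-t) X) * r * (ex (-t) X * ex t X) := by noncomm_ring
    _ = r := by rw [ex_neg_mul, ex_mul_neg]; simp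

/-- exponential metric increasing property -/
theorem emi {e : HilbertBasis ι ℂ H} {X Y : H →L[ℂ] H} (hX : MemS2 e X) (hY : MemS2 e Y) :
    hsNorm e (Y - X) ≤ gdist e (ex 1 X) (ex 1 Y) := by
  obtain ⟨W, hW, hWe⟩ := exists_W hX (memP_exp hY)
  rw [gdist_eq' hX.1 hW.1 hWe]
  have key : ∀ n : ℕ, hsNorm e (Y - X) ≤ Real.exp ((1/((n:ℝ)+1))/2 * ‖W‖) * hsNorm e W := by
    intro n
    have hn : (0:ℝ) < (n:ℝ)+1 := by positivity
    obtain ⟨N, hN⟩ : ∃ N : ℝ, N = (n:ℝ)+1 := ⟨_, rfl⟩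
    rw [← hN] at hn ⊢
    have hc : ∀ k : ℕ, ∃ K, MemS2 e K ∧ ex 1 K = ex (1/2) X * ex (k/N) W * ex (1/2) X :=
      fun k => (memP_conj hX (1/2) (memP_ex hW _)).exists_log
    choose K hK hKe using hc
    have hK0 : K 0 = X := by
      apply ex_inj (hK 0).1 hX.1
      rw [hKe, Nat.cast_zero, zero_div, ex_zero, mul_one, ex_mul]; norm_num
    have hKn : K (n+1) = Y := by
      apply ex_inj (hK _).1 hY.1
      rw [hKe]; push_cast
      rw [← hN, div_self hn.ne', hWe, conj_ex']
    have step : ∀ k, hsNorm e (K (k+1) - K k) ≤ Real.exp ((1/N)/2 * ‖W‖) * hsNorm e W * (1/N) := by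
      intro k
      refine le_trans ?_ (sinh_le hW.2 (by positivity))
      have hgs : star (ex (-(k/N/2)) W * ex (-(1/2)) X) = ex (-(1/2)) X * ex (-(k/N/2)) W := by
        rw [star_mul, star_ex _ hW.1, star_ex _ hX.1]
      have c : ∀ r, ex (-(k/N/2)) W * ex (-(1/2)) X * r * (ex (-(1/2)) X * ex (-(k/N/2)) W) =
        ex (-(k/N/2)) W * (ex (-(1/2)) X * r * ex (-(1/2)) X) * ex (-(k/N/2)) W := fun r => by noncomm_ring
      have := emi_local (g := ex (-(k/N/2)) W * ex (-(1/2)) X) (hK k).1 (hK (k+1)).1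
        (W := (1/N) • W) (hW.smul _).1 (isHS_sub (hK (k+1)).2 (hK k).2)
        ((isUnit_ex _ _).mul (isUnit_ex _ _))
        (by rw [hgs, c, hKe, conj_ex, ex_mul, ex_mul, ← ex_zero W]; congr 1; ring)
        (by rw [hgs, c, hKe, conj_ex, ex_mul, ex_mul, ex_smul]; congr 1; push_cast; field_simp; ring)
      rw [ex_smul, ex_smul] at this
      refine this.trans (le_of_eq ?_)
      congr 2
      · congr 1; ring
      · congr 1; ring
    have tel := dist_le_range_sum_of_dist_le (f := fun k => HSp.mk (K k) (hK k).2)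
      (d := fun _ => Real.exp ((1/N)/2 * ‖W‖) * hsNorm e W * (1/N)) (n+1) (by
        intro k _
        rw [dist_comm, dist_eq_norm, HSp.norm_eq', map_sub]
        exact step k)
    rw [dist_comm, dist_eq_norm, HSp.norm_eq', map_sub] at tel
    simp only [HSp.op_mk, hK0, hKn] at tel
    refine tel.trans (le_of_eq ?_)
    rw [Finset.sum_const, Finset.card_range, nsmul_eq_mul]
    push_cast
    rw [← hN]
    field_simp
  have lim : Filter.Tendsto (fun n : ℕ => Real.exp ((1/((n:ℝ)+1))/2 * ‖W‖) * hsNorm e W) Filter.atTop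
      (nhds (Real.exp (0/2 * ‖W‖) * hsNorm e W)) := by
    apply Filter.Tendsto.mul_const
    apply (Real.continuous_exp.tendsto _).comp
    exact (tendsto_one_div_add_atTop_nhds_zero_nat.div_const 2).mul_const _
  simp only [zero_div, zero_mul, Real.exp_zero, one_mul] at lim
  exact ge_of_tendsto' lim key

theorem hsNorm_nonneg (e : HilbertBasis ι ℂ H) (A : H →L[ℂ] H) : 0 ≤ hsNorm e A := Real.sqrt_nonneg _

theorem hsNorm_add_le {e : HilbertBasis ι ℂ H} {A B : H →L[ℂ] H} (hA : IsHS e A) (hB : IsHS e B) :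
    hsNorm e (A + B) ≤ hsNorm e A + hsNorm e B := by
  rw [← HSp.norm_mk A hA, ← HSp.norm_mk B hB, ← HSp.norm_mk _ (hA.add hB)]
  exact norm_add_le (HSp.mk A hA) (HSp.mk B hB)

theorem hsNorm_parallelogram {e : HilbertBasis ι ℂ H} {A B : H →L[ℂ] H} (hA : IsHS e A) (hB : IsHS e B) :
    hsNorm e (A + B) ^ 2 + hsNorm e (A - B) ^ 2 = 2 * (hsNorm e A ^ 2 + hsNorm e B ^ 2) := by
  rw [← HSp.norm_mk A hA, ← HSp.norm_mk B hB, ← HSp.norm_mk _ (hA.add hB), ← HSp.norm_mk _ (isHS_sub hA hB)]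
  have := parallelogram_law_with_norm ℝ (HSp.mk A hA) (HSp.mk B hB)
  exact this

theorem gdist_triangle {e : HilbertBasis ι ℂ H} {p q r : H →L[ℂ] H} (hp : MemP e p) (hq : MemP e q)
    (hr : MemP e r) : gdist e p r ≤ gdist e p q + gdist e q r := by
  obtain ⟨X, hX, rfl⟩ := hp.exists_log
  obtain ⟨A, hA, hAe⟩ := exists_W hX hq
  obtain ⟨B, hB, hBe⟩ := exists_W hX hr
  rw [gdist_eq' hX.1 hA.1 hAe, gdist_eq' hX.1 hB.1 hBe, ← gdist_conj hX (-(1/2)) hq hr, ← hAe, ← hBe]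
  have h1 := emi hA hB
  have h2 := hsNorm_add_le hA.2 (isHS_sub hB.2 hA.2)
  rw [add_sub_cancel] at h2
  linarith

theorem gdist_mid {e : HilbertBasis ι ℂ H} {X W : H →L[ℂ] H} (hX : MemS2 e X) (hW : MemS2 e W) (t : ℝ) :
    gdist e (ex 1 X) (ex (1/2) X * ex t W * ex (1/2) X) = |t| * hsNorm e W := by
  rw [gdist_eq' hX.1 (hW.smul t).1 (by rw [conj_ex, ex_smul, one_mul]), hsNorm_smul e t hW.2]

theorem semipar {e : HilbertBasis ι ℂ H} {X W r : H →L[ℂ] H} (hX : MemS2 e X) (hW : MemS2 e W)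
    (hr : MemP e r) :
    gdist e r (ex (1/2) X * ex (1/2) W * ex (1/2) X) ^ 2 ≤
      1/2 * gdist e r (ex 1 X) ^ 2 + 1/2 * gdist e r (ex (1/2) X * ex 1 W * ex (1/2) X) ^ 2
        - 1/4 * hsNorm e W ^ 2 := by
  have T : ∀ q, MemP e q → gdist e r q = gdist e (ex (-(1/4)) W * (ex (-(1/2)) X * r * ex (-(1/2)) X) * ex (-(1/4)) W)
      (ex (-(1/4)) W * (ex (-(1/2)) X * q * ex (-(1/2)) X) * ex (-(1/4)) W) := fun q hq => by
    rw [gdist_conj hW _ (memP_conj hX _ hr) (memP_conj hX _ hq), gdist_conj hX _ hr hq]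
  have hr' := memP_conj hW (-(1/4)) (memP_conj hX (-(1/2)) hr)
  rw [T _ (memP_exp hX), T _ (memP_conj hX _ (memP_ex hW _)), T _ (memP_conj hX _ (memP_ex hW _)),
    conj_ex, conj_ex]
  obtain ⟨R, hR, hRe⟩ := hr'.exists_log
  rw [← hRe]
  have e1 : ex (-(1/4)) W * ex (1/2) W * ex (-(1/4)) W = 1 := by
    rw [ex_mul, ex_mul, ← ex_zero W]; norm_num
  have e2 : ex (-(1/4)) W * ex 1 W * ex (-(1/4)) W = ex 1 ((1/2 : ℝ) • W) := by
    rw [ex_mul, ex_mul, ex_smul]; norm_num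
  have e3 : ex (-(1/4)) W * (ex (-(1/2)) X * ex 1 X * ex (-(1/2)) X) * ex (-(1/4)) W = ex 1 (-((1/2 : ℝ) • W)) := by
    have := ex_conj_one hX.1
    rw [star_ex _ hX.1] at this
    rw [this, mul_one, ex_mul, ex_neg, ex_smul]; norm_num
  rw [e1, e2, e3, gdist_comm (memP_exp hR) (memP_one e), gdist_one hR.1]
  have hV := hW.smul (1/2)
  have f1 := emi hR hV
  have f2 := emi hR hV.neg
  have f3 := hsNorm_parallelogram hR.2 hV.2
  rw [← hsNorm_neg, neg_sub] at f1
  rw [← hsNorm_neg, neg_sub, sub_neg_eq_add] at f2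
  rw [hsNorm_smul e _ hW.2, abs_of_pos (by norm_num)] at f3
  have g1 := pow_le_pow_left₀ (hsNorm_nonneg e _) f1 2
  have g2 := pow_le_pow_left₀ (hsNorm_nonneg e _) f2 2
  nlinarith

/-- weak quadrilateral inequality -/
theorem quad {e : HilbertBasis ι ℂ H} {a b c d : H →L[ℂ] H} (ha : MemP e a) (hb : MemP e b) (hc : MemP e c)
    (hd : MemP e d) :
    gdist e a c ^ 2 + gdist e b d ^ 2 ≤ gdist e a b ^ 2 + gdist e b c ^ 2 + gdist e c d ^ 2 + gdist e d a ^ 2 := by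
  obtain ⟨X, hX, rfl⟩ := ha.exists_log
  obtain ⟨W, hW, hWe⟩ := exists_W hX hc
  have hc' : ex (1/2) X * ex 1 W * ex (1/2) X = c := by rw [hWe, conj_ex']
  have h1 := semipar hX hW hb
  have h2 := semipar hX hW hd
  have hm := memP_conj hX (1/2) (memP_ex hW (1/2))
  have h3 := gdist_triangle hb hm hd
  rw [gdist_comm hm hd] at h3
  rw [hc'] at h1 h2
  rw [gdist_eq' hX.1 hW.1 hWe, gdist_comm ha hb, gdist_comm hc hd]
  have h4 := pow_le_pow_left₀ (gdist_nonneg e _ _) h3 2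
  nlinarith [sq_nonneg (gdist e b (ex (1/2) X * ex (1/2) W * ex (1/2) X) - gdist e d (ex (1/2) X * ex (1/2) W * ex (1/2) X))]


/-- the subspace of `HSp e` corresponding to `E` -/
def Esub (e : HilbertBasis ι ℂ H) (E : Submodule ℝ (H →L[ℂ] H)) : Submodule ℝ (HSp e) :=
  E.comap (HSp.op (e := e) : HSp e →ₗ[ℝ] (H →L[ℂ] H))

theorem mem_Esub {e : HilbertBasis ι ℂ H} {E : Submodule ℝ (H →L[ℂ] H)} {A : HSp e} :
    A ∈ Esub e E ↔ HSp.op A ∈ E := Iff.rfl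

theorem Esub_closed {e : HilbertBasis ι ℂ H} {E : Submodule ℝ (H →L[ℂ] H)}
    (hE : ∀ X ∈ E, MemS2 e X) (hclosed : IsHSClosed e (E : Set (H →L[ℂ] H))) :
    IsClosed (Esub e E : Set (HSp e)) := by
  apply isClosed_of_closure_subset
  intro A hA
  have h1 : HSp.starL A = A := by
    have hc : IsClosed {A : HSp e | HSp.starL A = A} :=
      isClosed_eq HSp.starL.continuous continuous_id
    refine closure_minimal ?_ hc hA
    intro B hB
    exact HSp.op_inj ((HSp.op_starL B).trans (hE _ hB).1)
  refine hclosed (HSp.op A) ⟨?_, A.isHS⟩ ?_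
  · rw [isSelfAdjoint_iff, ← HSp.op_starL, h1]
  · intro ε hε
    obtain ⟨B, hB, hd⟩ := Metric.mem_closure_iff.1 hA ε hε
    refine ⟨HSp.op B, hB, ?_⟩
    rw [← map_sub, ← HSp.norm_eq', ← dist_eq_norm]
    exact hd

/-- `Z ↦ ZG - GZ` -/
def adT {e : HilbertBasis ι ℂ H} (G : H →L[ℂ] H) : HSp e →L[ℝ] HSp e := HSp.mulR G - HSp.mulL G

theorem op_adT {e : HilbertBasis ι ℂ H} (G : H →L[ℂ] H) (Z : HSp e) :
    HSp.op (adT G Z) = HSp.op Z * G - G * HSp.op Z := by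
  simp [adT, HSp.op_mulL, HSp.op_mulR]

theorem DK_deriv {e : HilbertBasis ι ℂ H} (G : H →L[ℂ] H) (s : ℝ) :
    HasDerivAt (fun s => (DK G G s : HSp e →L[ℝ] HSp e)) ((adT G).comp (DK G G s)) s := by
  have h1 : HasDerivAt (fun s => ex (-s) G) (-(G * ex (-s) G)) s := by
    have := (ex_deriv' G (-s)).scomp s (hasDerivAt_neg s)
    simpa [Function.comp_def] using this
  have h2 : HasDerivAt (fun s : ℝ => (HSp.mulL (ex (-s) G) : HSp e →L[ℝ] HSp e))
      (HSp.mulL (-(G * ex (-s) G))) s :=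
    (HSp.mulL (e := e)).hasFDerivAt.comp_hasDerivAt s h1
  have h3 : HasDerivAt (fun s : ℝ => (HSp.mulR (ex s G) : HSp e →L[ℝ] HSp e))
      (HSp.mulR (ex s G * G)) s :=
    (HSp.mulR (e := e)).hasFDerivAt.comp_hasDerivAt s (ex_deriv G s)
  have h4 := h2.clm_comp h3
  have h5 : (adT G).comp (DK G G s) = (HSp.mulL (-(G * ex (-s) G))).comp (HSp.mulR (ex s G)) +
      (HSp.mulL (ex (-s) G)).comp (HSp.mulR (e := e) (ex s G * G)) := by
    ext Z : 1
    apply HSp.op_inj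
    simp only [ContinuousLinearMap.comp_apply, ContinuousLinearMap.add_apply, map_add, op_adT, op_DK,
      HSp.op_mulL, HSp.op_mulR]
    noncomm_ring
  rw [h5]
  exact h4

theorem DK_eq_exp {e : HilbertBasis ι ℂ H} (G : H →L[ℂ] H) (s : ℝ) :
    (DK G G s : HSp e →L[ℝ] HSp e) = NormedSpace.exp (s • (adT G : HSp e →L[ℝ] HSp e)) := by
  have key : ∀ t : ℝ, HasDerivAt (fun s : ℝ => NormedSpace.exp ((-s) • (adT G : HSp e →L[ℝ] HSp e)) * DK G G s) 0 t := by
    intro t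
    have h1 : HasDerivAt (fun s : ℝ => NormedSpace.exp ((-s) • (adT G : HSp e →L[ℝ] HSp e)))
        (-(NormedSpace.exp ((-t) • (adT G : HSp e →L[ℝ] HSp e)) * adT G)) t := by
      have := (hasDerivAt_exp_smul_const (adT G : HSp e →L[ℝ] HSp e) (-t)).scomp t (hasDerivAt_neg t)
      simpa [Function.comp_def] using this
    have h2 := h1.mul (DK_deriv (e := e) G t)
    have h3 : -(NormedSpace.exp ((-t) • (adT G : HSp e →L[ℝ] HSp e)) * adT G) * DK G G t +
        NormedSpace.exp ((-t) • (adT G : HSp e →L[ℝ] HSp e)) * (adT G).comp (DK G G t) = 0 := by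
      change -(NormedSpace.exp ((-t) • (adT G : HSp e →L[ℝ] HSp e)) * adT G) * DK G G t +
        NormedSpace.exp ((-t) • (adT G : HSp e →L[ℝ] HSp e)) * ((adT G) * (DK G G t)) = 0
      noncomm_ring
    rw [← h3]
    exact h2
  have hconst := is_const_of_deriv_eq_zero (fun t => (key t).differentiableAt) (fun t => (key t).deriv) s 0
  have h0 : (DK G G 0 : HSp e →L[ℝ] HSp e) = 1 := by
    ext Z : 1
    exact DK_zero G G Z
  simp only [neg_zero, zero_smul, NormedSpace.exp_zero, h0, mul_one] at hconst
  let := NormedAlgebra.restrictScalars ℚ ℝ (HSp e →L[ℝ] HSp e)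
  have hinv : NormedSpace.exp (s • (adT G : HSp e →L[ℝ] HSp e)) * NormedSpace.exp ((-s) • (adT G : HSp e →L[ℝ] HSp e)) = 1 := by
    rw [← NormedSpace.exp_add_of_commute, ← add_smul, add_neg_cancel, zero_smul, NormedSpace.exp_zero]
    exact ((Commute.refl _).smul_left s).smul_right (-s)
  calc (DK G G s : HSp e →L[ℝ] HSp e) = (NormedSpace.exp (s • (adT G : HSp e →L[ℝ] HSp e)) * NormedSpace.exp ((-s) • (adT G : HSp e →L[ℝ] HSp e))) * DK G G s := by
        rw [hinv, one_mul]
    _ = NormedSpace.exp (s • (adT G : HSp e →L[ℝ] HSp e)) * (NormedSpace.exp ((-s) • (adT G : HSp e →L[ℝ] HSp e)) * DK G G s) := by rw [mul_assoc]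
    _ = _ := by rw [hconst, mul_one]

theorem DK_sym_mem {e : HilbertBasis ι ℂ H} {E : Submodule ℝ (H →L[ℂ] H)}
    (hE : ∀ X ∈ E, MemS2 e X) (hclosed : IsHSClosed e (E : Set (H →L[ℂ] H)))
    (hbrk : ∀ X ∈ E, ∀ Y ∈ E, brk X (brk X Y) ∈ E) {G : H →L[ℂ] H} (hG : G ∈ E) (s : ℝ)
    {Z : HSp e} (hZ : Z ∈ Esub e E) : DK G G s Z + DK G G (-s) Z ∈ Esub e E := by
  obtain ⟨T, hT⟩ : ∃ T : HSp e →L[ℝ] HSp e, T = adT G := ⟨_, rfl⟩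
  have h1 : ∀ s, HasSum (fun n : ℕ => ((n.factorial : ℝ)⁻¹ * s ^ n) • (T ^ n) Z) (DK G G s Z) := by
    intro s
    have := NormedSpace.exp_series_hasSum_exp' (𝕂 := ℝ) (s • T)
    rw [hT, ← DK_eq_exp, ← hT] at this
    have h2 := (ContinuousLinearMap.apply ℝ (HSp e) Z).hasSum this
    simp only [Function.comp_def, ContinuousLinearMap.apply_apply, smul_pow, ContinuousLinearMap.smul_apply, smul_smul] at h2
    exact h2
  have heven : ∀ k : ℕ, (T ^ (2 * k)) Z ∈ Esub e E := by
    intro k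
    induction k with
    | zero => simpa using hZ
    | succ k ih =>
      have : (T ^ (2 * (k + 1))) Z = T (T ((T ^ (2 * k)) Z)) := by
        rw [mul_add, mul_one, add_comm, pow_add, sq]; rfl
      rw [this, mem_Esub, hT, op_adT, op_adT, ← hT]
      have := hbrk G hG _ ih
      unfold brk at this
      convert this using 1
      change _ = G * (G * HSp.op ((T ^ (2 * k)) Z) - HSp.op ((T ^ (2 * k)) Z) * G) - (G * HSp.op ((T ^ (2 * k)) Z) - HSp.op ((T ^ (2 * k)) Z) * G) * G
      noncomm_ring
  have h3 := (h1 s).add (h1 (-s))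
  refine (Esub_closed hE hclosed).mem_of_tendsto h3 (Filter.Eventually.of_forall fun F => ?_)
  refine Submodule.sum_mem _ fun n _ => ?_
  rcases Nat.even_or_odd' n with ⟨k, rfl | rfl⟩
  · exact Submodule.add_mem _ (Submodule.smul_mem _ _ (heven k)) (Submodule.smul_mem _ _ (heven k))
  · rw [← add_smul, Odd.neg_pow ⟨k, rfl⟩]
    simp

instance Esub_complete {e : HilbertBasis ι ℂ H} {E : Submodule ℝ (H →L[ℂ] H)}
    [hF : Fact (IsClosed (Esub e E : Set (HSp e)))] : CompleteSpace (Esub e E) :=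
  hF.out.completeSpace_coe

theorem dI_mem {e : HilbertBasis ι ℂ H} {E : Submodule ℝ (H →L[ℂ] H)}
    (hE : ∀ X ∈ E, MemS2 e X) (hclosed : IsHSClosed e (E : Set (H →L[ℂ] H)))
    (hbrk : ∀ X ∈ E, ∀ Y ∈ E, brk X (brk X Y) ∈ E) {G : H →L[ℂ] H} (hG : G ∈ E)
    {Z : HSp e} (hZ : Z ∈ Esub e E) : dI G G Z (-(1/2)) (1/2) ∈ Esub e E := by
  have : Fact (IsClosed (Esub e E : Set (HSp e))) := ⟨Esub_closed hE hclosed⟩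
  rw [← Submodule.orthogonal_orthogonal (Esub e E), Submodule.mem_orthogonal]
  intro y hy
  unfold dI
  have h1 := ContinuousLinearMap.intervalIntegral_comp_comm (innerSL ℝ y)
      ((DK_cont' G G Z).intervalIntegrable (μ := MeasureTheory.volume) (-(1/2)) (1/2))
  simp only [innerSL_apply_apply] at h1
  rw [← h1]
  have h2 := intervalIntegral.integral_comp_neg (a := -(1/2)) (b := 1/2)
      (fun s : ℝ => inner ℝ y (DK G G s Z))
  rw [neg_neg] at h2
  have h3 : ∀ s, inner ℝ y (DK G G (-s) Z) = - inner ℝ y (DK G G s Z) := by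
    intro s
    have := (Submodule.mem_orthogonal' _ _).1 hy _ (DK_sym_mem hE hclosed hbrk hG s hZ)
    rw [inner_add_right] at this
    linarith
  simp only [h3, intervalIntegral.integral_neg] at h2
  linarith

/-- the operator `Z ↦ dI G G Z (-1/2) (1/2)` -/
def SG {e : HilbertBasis ι ℂ H} (G : H →L[ℂ] H) : HSp e →L[ℝ] HSp e :=
  ∫ s in (-(1/2) : ℝ)..(1/2), DK G G s

theorem SG_apply {e : HilbertBasis ι ℂ H} (G : H →L[ℂ] H) (Z : HSp e) :
    SG G Z = dI G G Z (-(1/2)) (1/2) := by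
  unfold SG dI
  have := ContinuousLinearMap.intervalIntegral_comp_comm (ContinuousLinearMap.apply ℝ (HSp e) Z)
    ((DK_cont (e := e) G G).intervalIntegrable (μ := MeasureTheory.volume) (-(1/2)) (1/2))
  exact this.symm

theorem exists_V {e : HilbertBasis ι ℂ H} {E : Submodule ℝ (H →L[ℂ] H)}
    (hE : ∀ X ∈ E, MemS2 e X) (hclosed : IsHSClosed e (E : Set (H →L[ℂ] H)))
    (hbrk : ∀ X ∈ E, ∀ Y ∈ E, brk X (brk X Y) ∈ E) {G : H →L[ℂ] H} (hG : G ∈ E)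
    {W : HSp e} (hW : W ∈ Esub e E) : ∃ V ∈ Esub e E, dI G G V (-(1/2)) (1/2) = W ∧ ‖V‖ ≤ ‖W‖ := by
  have : Fact (IsClosed (Esub e E : Set (HSp e))) := ⟨Esub_closed hE hclosed⟩
  let B : Esub e E →L[ℝ] Esub e E →L[ℝ] ℝ :=
    (innerSL ℝ).bilinearComp ((SG G).comp (Esub e E).subtypeL) (Esub e E).subtypeL
  have hB : ∀ u v : Esub e E, B u v = inner ℝ (dI G G (u : HSp e) (-(1/2)) (1/2)) (v : HSp e) := by
    intro u v
    rw [← SG_apply]; rfl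
  have hco : IsCoercive B := by
    refine ⟨1, one_pos, fun u => ?_⟩
    rw [hB]
    have := inner_dI_ge (hE G hG).1 (hE G hG).1 (u : HSp e)
    rw [one_mul, ← sq]
    exact this
  let V := hco.continuousLinearEquivOfBilin.symm ⟨W, hW⟩
  have hV : ∀ v : Esub e E, inner ℝ W (v : HSp e) = inner ℝ (dI G G (V : HSp e) (-(1/2)) (1/2)) (v : HSp e) := by
    intro v
    rw [← hB, ← hco.continuousLinearEquivOfBilin_apply V v]
    simp [V]
  have hVd : dI G G (V : HSp e) (-(1/2)) (1/2) = W := by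
    have hm : dI G G (V : HSp e) (-(1/2)) (1/2) - W ∈ Esub e E :=
      Submodule.sub_mem _ (dI_mem hE hclosed hbrk hG V.2) hW
    have := hV ⟨_, hm⟩
    have h0 : inner ℝ (dI G G (V : HSp e) (-(1/2)) (1/2) - W) (dI G G (V : HSp e) (-(1/2)) (1/2) - W) = 0 := by
      rw [inner_sub_left]
      exact sub_eq_zero.2 this.symm
    exact sub_eq_zero.1 (inner_self_eq_zero.1 h0)
  refine ⟨V, V.2, hVd, ?_⟩
  have := norm_le_dI (hE G hG).1 (hE G hG).1 (V : HSp e)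
  rwa [hVd] at this


theorem hsNorm_mul_left_le {e : HilbertBasis ι ℂ H} (A : H →L[ℂ] H) {B : H →L[ℂ] H} (hB : IsHS e B) :
    hsNorm e (A * B) ≤ ‖A‖ * hsNorm e B := by
  have := HSp.norm_mulL_le A (HSp.mk B hB)
  rwa [HSp.norm_eq', HSp.op_mulL, HSp.norm_mk, HSp.op_mk] at this

theorem hsNorm_mul_right_le {e : HilbertBasis ι ℂ H} {B : H →L[ℂ] H} (hB : IsHS e B) (A : H →L[ℂ] H) :
    hsNorm e (B * A) ≤ hsNorm e B * ‖A‖ := by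
  have := HSp.norm_mulR_le A (HSp.mk B hB)
  rwa [HSp.norm_eq', HSp.op_mulR, HSp.norm_mk, HSp.op_mk] at this

theorem hsNorm_sub_le {e : HilbertBasis ι ℂ H} {A B : H →L[ℂ] H} (hA : IsHS e A) (hB : IsHS e B) :
    hsNorm e (A - B) ≤ hsNorm e A + hsNorm e B := by
  have := hsNorm_add_le hA (hB.smul (-1))
  rw [hsNorm_smul e _ hB] at this
  simpa [sub_eq_add_neg] using this

theorem norm_le_hsNorm {e : HilbertBasis ι ℂ H} {A : H →L[ℂ] H} (hA : IsHS e A) : ‖A‖ ≤ hsNorm e A := by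
  have := HSp.norm_op_le (HSp.mk A hA)
  rwa [HSp.norm_mk, HSp.op_mk] at this

theorem norm_log_le {e : HilbertBasis ι ℂ H} {T T' W : H →L[ℂ] H} (hW : MemS2 e W) (hT : IsUnit T)
    (h1 : T * star T = ex 1 W) (h2 : T' * star T = 1) : hsNorm e W ≤ hsNorm e (T - T') := by
  have h0 := emi_local (e := e) (X := 0) (Y := W) (W := W) (g := 1) (IsSelfAdjoint.zero _) hW.1 hW.1
    (by simpa using hW.2) isUnit_one (by simp [ex_op_zero]) (by simp)
  rw [sub_zero] at h0
  refine h0.trans (le_of_eq ?_)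
  have hT' : T' = ex (-1) W * T := by
    apply hT.star.mul_right_cancel
    rw [h2, mul_assoc, h1, ex_neg_mul]
  obtain ⟨v, hv⟩ : ∃ v, v = ex (-(1/2)) W * T := ⟨_, rfl⟩
  have hvv : v * star v = 1 := by
    rw [hv, star_mul, star_ex _ hW.1]
    calc ex (-(1/2)) W * T * (star T * ex (-(1/2)) W) = ex (-(1/2)) W * (T * star T) * ex (-(1/2)) W := by
          noncomm_ring
      _ = 1 := by rw [h1, ex_mul, ex_mul, ← ex_zero W]; norm_num
  have hTv : T = ex (1/2) W * v := by
    rw [hv, ← mul_assoc, ex_mul_neg, one_mul]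
  have hTv' : T' = ex (-(1/2)) W * v := by
    rw [hv, ← mul_assoc, ex_mul, hT']; norm_num
  rw [hTv', hTv, ← sub_mul, hsNorm_mul_right_unit e hvv]

/-- first order remainder for exp -/
theorem ex_taylor {e : HilbertBasis ι ℂ H} {X : H →L[ℂ] H} (hX : IsHS e X) {t L : ℝ} (ht : |t| ≤ 1)
    (hL : Real.exp ‖X‖ ≤ L) :
    IsHS e (ex t X - 1 - t • X) ∧ hsNorm e (ex t X - 1 - t • X) ≤ t ^ 2 * (hsNorm e X ^ 2 * L) := by
  have hhs : IsHS e (ex t X - 1 - t • X) := isHS_sub (isHS_ex_sub_one t hX) (hX.smul t)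
  refine ⟨hhs, ?_⟩
  obtain ⟨Z, hZ⟩ : ∃ Z, Z = HSp.mk X hX := ⟨_, rfl⟩
  have hZo : HSp.op Z = X - 0 := by rw [hZ]; simp [HSp.op_mk]
  have hZn : ‖Z‖ = hsNorm e X := by rw [hZ, HSp.norm_mk]
  have hd : ∀ s, HSp.op (dI 0 X Z 0 s) = ex s X - 1 := by
    intro s
    rw [op_dI hZo, ex_op_zero, ex_op_zero, ex_zero, one_mul, one_mul]
  have hb : ∀ s, |s| ≤ |t| → ‖ex s X - 1‖ ≤ L * hsNorm e X * |t| := by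
    intro s hs
    rw [← hd]
    refine (HSp.norm_op_le _).trans ?_
    refine (norm_dI_le 0 X Z (δ := 1) (by simp) (hs.trans ht)).trans ?_
    rw [norm_zero, zero_add, one_mul, hZn, sub_zero]
    have := hsNorm_nonneg e X
    have hL0 : 0 ≤ L := (Real.exp_pos _).le.trans hL
    gcongr
  have hdiff : HSp.mk (ex t X - 1 - t • X) hhs = ∫ s in (0:ℝ)..t, (DK 0 X s Z - Z) := by
    rw [intervalIntegral.integral_sub ((DK_cont' 0 X Z).intervalIntegrable _ _)
      (continuous_const.intervalIntegrable _ _), intervalIntegral.integral_const, sub_zero]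
    apply HSp.op_inj
    rw [map_sub, map_smul]
    have := hd t
    unfold dI at this
    rw [this, HSp.op_mk, hZo, sub_zero]
  rw [← HSp.norm_mk _ hhs, hdiff]
  have := intervalIntegral.norm_integral_le_of_norm_le_const (a := 0) (b := t)
    (f := fun s => DK 0 X s Z - Z) (C := hsNorm e X * (L * hsNorm e X * |t|)) (by
      intro s hs
      have hs' : |s| ≤ |t| := by
        rw [Set.mem_uIoc] at hs
        rcases hs with hs | hs
        · rw [abs_of_pos hs.1, abs_of_pos (by linarith)]; exact hs.2
        · rw [abs_of_nonpos hs.2, abs_of_nonpos (by linarith)]; linarith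
      have : DK 0 X s Z - Z = HSp.mulR (ex s X - 1) Z := by
        apply HSp.op_inj
        rw [map_sub, op_DK, HSp.op_mulR, ex_op_zero]
        noncomm_ring
      rw [this]
      refine (HSp.norm_mulR_le _ _).trans ?_
      rw [hZn]
      exact mul_le_mul_of_nonneg_left (hb s hs') (hsNorm_nonneg e X))
  refine this.trans (le_of_eq ?_)
  rw [sub_zero, ← sq_abs t]; ring

theorem ex_lip {e : HilbertBasis ι ℂ H} {A B : H →L[ℂ] H} (h : IsHS e (B - A)) {s R : ℝ} (hs : |s| ≤ 1)
    (hA : ‖A‖ ≤ R) (hB : ‖B‖ ≤ R) :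
    ‖ex s B - ex s A‖ ≤ Real.exp R ^ 3 * hsNorm e (B - A) := by
  have h1 := op_dI (A := A) (B := B) (Z := HSp.mk (B - A) h) rfl 0 s
  rw [neg_zero, ex_zero, ex_zero, one_mul] at h1
  have h2 : ex s B - ex s A = ex s A * HSp.op (dI A B (HSp.mk (B - A) h) 0 s) := by
    rw [h1, mul_sub, ← mul_assoc, ex_mul_neg, one_mul, mul_one]
  rw [h2]
  have h3 := norm_dI_le A B (HSp.mk (B - A) h) (a := 0) (b := s) (δ := 1) (by simp) hs
  rw [one_mul, HSp.norm_mk, sub_zero] at h3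
  have h4 : Real.exp (‖A‖ + ‖B‖) ≤ Real.exp R ^ 2 := by
    rw [sq, ← Real.exp_add]; apply Real.exp_le_exp.2; linarith
  have h0 := hsNorm_nonneg e (B - A)
  calc _ ≤ ‖ex s A‖ * ‖HSp.op (dI A B (HSp.mk (B - A) h) 0 s)‖ := norm_mul_le _ _
    _ ≤ Real.exp R * (Real.exp R ^ 2 * hsNorm e (B - A) * 1) := by
        gcongr
        · exact norm_ex_le' hs hA
        · refine (HSp.norm_op_le _).trans (h3.trans ?_)
          gcongr
    _ = _ := by ring

/-- the error term -/
theorem piece {e : HilbertBasis ι ℂ H} {X G G' : H →L[ℂ] H} (hX : IsHS e X) (h : IsHS e (G' - G))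
    {t s R ε M : ℝ} (ht : |t| ≤ 1) (hs : |s| ≤ 1) (hG : ‖G‖ ≤ R) (hG' : ‖G'‖ ≤ R) (hXR : ‖X‖ ≤ R)
    (htε : |t| = ε) (hM : hsNorm e (G' - G) ≤ ε * M) :
    ∃ Q, IsHS e Q ∧ Q = ex (-s) G * (ex t X - 1) * ex s G' - t • (ex (-s) G * X * ex s G) ∧
      hsNorm e Q ≤ ε ^ 2 * (hsNorm e X ^ 2 * Real.exp R ^ 3 + hsNorm e X * M * Real.exp R ^ 4) := by
  obtain ⟨t1, t2⟩ := ex_taylor hX ht (Real.exp_le_exp.2 hXR)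
  have hl := ex_lip h hs hG hG'
  have q1 := t1.mul_right (ex s G')
  have q2 := (hX.smul t).mul_right (ex s G' - ex s G)
  refine ⟨ex (-s) G * ((ex t X - 1 - t • X) * ex s G' + (t • X) * (ex s G' - ex s G)),
    (q1.add q2).mul_left _, ?_, ?_⟩
  · have : t • (ex (-s) G * X * ex s G) = ex (-s) G * (t • X) * ex s G := by simp
    rw [this]
    noncomm_ring
  · have hx := hsNorm_nonneg e X
    have hε : 0 ≤ ε := by rw [← htε]; exact abs_nonneg t
    have htt : t ^ 2 = ε ^ 2 := by rw [← htε, sq_abs]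
    have a1 : hsNorm e ((ex t X - 1 - t • X) * ex s G') ≤ ε ^ 2 * (hsNorm e X ^ 2 * Real.exp R) * Real.exp R := by
      refine (hsNorm_mul_right_le t1 _).trans ?_
      rw [← htt]
      gcongr
      exact norm_ex_le' hs hG'
    have a2 : hsNorm e ((t • X) * (ex s G' - ex s G)) ≤ ε * hsNorm e X * (Real.exp R ^ 3 * (ε * M)) := by
      refine (hsNorm_mul_right_le (hX.smul t) _).trans ?_
      rw [hsNorm_smul e t hX, htε]
      gcongr
      refine hl.trans ?_
      gcongr
    have a3 := hsNorm_add_le q1 q2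
    refine (hsNorm_mul_left_le _ (q1.add q2)).trans ?_
    have a4 : ‖ex (-s) G‖ ≤ Real.exp R := norm_ex_le' (by rwa [abs_neg]) hG
    calc _ ≤ Real.exp R * (ε ^ 2 * (hsNorm e X ^ 2 * Real.exp R) * Real.exp R + ε * hsNorm e X * (Real.exp R ^ 3 * (ε * M))) := by
          have := hsNorm_nonneg e ((ex t X - 1 - t • X) * ex s G' + (t • X) * (ex s G' - ex s G))
          gcongr
          linarith
      _ = _ := by ring

theorem local_step {e : HilbertBasis ι ℂ H} {E : Submodule ℝ (H →L[ℂ] H)}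
    (hE : ∀ X ∈ E, MemS2 e X) (hclosed : IsHSClosed e (E : Set (H →L[ℂ] H)))
    (hbrk : ∀ X ∈ E, ∀ Y ∈ E, brk X (brk X Y) ∈ E) {X : H →L[ℂ] H} (hX : X ∈ E) (R : ℝ) :
    ∃ C : ℝ, 0 ≤ C ∧ ∀ ε : ℝ, 0 < ε → ε ≤ 1 → ∀ G ∈ E, hsNorm e G ≤ R → ∃ G' ∈ E,
      gdist e (ex 1 G') (ex ε X * ex 1 G * ex ε X) ≤ C * ε ^ 2 := by
  have hXS := hE X hX
  obtain ⟨x, hx⟩ : ∃ x, x = hsNorm e X := ⟨_, rfl⟩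
  have hx0 : 0 ≤ x := by rw [hx]; exact hsNorm_nonneg _ _
  obtain ⟨M, hM⟩ : ∃ M, M = 2 * Real.exp R * x := ⟨_, rfl⟩
  have hM0 : 0 ≤ M := by rw [hM]; positivity
  obtain ⟨R', hR'⟩ : ∃ R', R' = R + M + x := ⟨_, rfl⟩
  refine ⟨2 * (x ^ 2 * Real.exp R' ^ 3 + x * M * Real.exp R' ^ 4) + Real.exp R' ^ 4 * M ^ 2, by positivity, ?_⟩
  intro ε hε hε1 G hG hGR
  have hGS := hE G hG
  have hR0 : 0 ≤ R := (hsNorm_nonneg _ _).trans hGR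
  have hGn : ‖G‖ ≤ R := (norm_le_hsNorm hGS.2).trans hGR
  have hXn : ‖X‖ ≤ R' := (norm_le_hsNorm hXS.2).trans (by rw [hR', ← hx]; linarith)
  obtain ⟨Xh, hXh⟩ : ∃ Xh, Xh = HSp.mk X hXS.2 := ⟨_, rfl⟩
  have hXho : HSp.op Xh = X := by rw [hXh]; rfl
  have hXhn : ‖Xh‖ = x := by rw [hXh, HSp.norm_mk, hx]
  have hWm := DK_sym_mem hE hclosed hbrk hG (1/2) (Z := Xh) (by rw [mem_Esub, hXho]; exact hX)
  obtain ⟨V, hVE, hVd, hVn⟩ := exists_V hE hclosed hbrk hG hWm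
  have hVM : ‖V‖ ≤ M := by
    refine hVn.trans ?_
    have b : ∀ s : ℝ, |s| ≤ 1/2 → ‖DK G G s Xh‖ ≤ Real.exp R * x := by
      intro s hs
      refine (norm_DK_le G G s Xh).trans ?_
      rw [hXhn]
      gcongr
      nlinarith [norm_nonneg G, abs_nonneg s]
    have b1 := b (1/2) (by rw [abs_of_pos (by norm_num)])
    have b2 := b (-(1/2)) (by rw [abs_neg, abs_of_pos (by norm_num)])
    have := norm_add_le (DK G G (1/2) Xh) (DK G G (-(1/2)) Xh)
    rw [hM]; linarith
  obtain ⟨G', hG'⟩ : ∃ G', G' = G + ε • HSp.op V := ⟨_, rfl⟩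
  have hG'E : G' ∈ E := by rw [hG']; exact E.add_mem hG (E.smul_mem _ hVE)
  have hG'S := hE G' hG'E
  have hdiff : HSp.op (ε • V) = G' - G := by rw [hG', map_smul]; abel
  have hdHS : IsHS e (G' - G) := isHS_sub hG'S.2 hGS.2
  have hdn : hsNorm e (G' - G) ≤ ε * M := by
    rw [← hdiff, ← HSp.norm_eq', norm_smul, Real.norm_of_nonneg hε.le]
    gcongr
  have hG'n : ‖G'‖ ≤ R' := by
    have h1 := norm_add_le G (G' - G)
    rw [add_sub_cancel] at h1
    have h2 := norm_le_hsNorm hdHS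
    rw [hR']
    nlinarith
  have hGn' : ‖G‖ ≤ R' := hGn.trans (by rw [hR']; linarith)
  refine ⟨G', hG'E, ?_⟩
  obtain ⟨p, hp⟩ : ∃ p, p = ex ε X * ex 1 G * ex ε X := ⟨_, rfl⟩
  have hpP : MemP e p := by rw [hp]; exact memP_conj hXS ε (memP_exp hGS)
  obtain ⟨K, hK, hKe⟩ := hpP.exists_log
  obtain ⟨W, hW, hWe⟩ := (memP_conj hGS (-(1/2)) (memP_conj hXS (-ε) (memP_exp hG'S))).exists_log
  obtain ⟨T, hT⟩ : ∃ T, T = ex (-(1/2)) G * ex (-ε) X * ex (1/2) G' := ⟨_, rfl⟩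
  obtain ⟨T', hT'⟩ : ∃ T', T' = ex (1/2) G * ex ε X * ex (-(1/2)) G' := ⟨_, rfl⟩
  have hsT : star T = ex (1/2) G' * ex (-ε) X * ex (-(1/2)) G := by
    rw [hT, star_mul, star_mul, star_ex _ hG'S.1, star_ex _ hXS.1, star_ex _ hGS.1, mul_assoc]
  have hTT : T * star T = ex 1 W := by
    rw [hWe, hsT, hT]
    calc _ = ex (-(1/2)) G * (ex (-ε) X * (ex (1/2) G' * ex (1/2) G') * ex (-ε) X) * ex (-(1/2)) G := by noncomm_ring
      _ = _ := by rw [ex_mul, add_halves]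
  have hTT' : T' * star T = 1 := by
    rw [hsT, hT']
    calc _ = ex (1/2) G * (ex ε X * (ex (-(1/2)) G' * ex (1/2) G') * ex (-ε) X) * ex (-(1/2)) G := by noncomm_ring
      _ = 1 := by rw [ex_neg_mul, mul_one, ex_mul_neg, mul_one, ex_mul_neg]
  have hTu : IsUnit T := by
    rw [hT]; exact ((isUnit_ex _ _).mul (isUnit_ex _ _)).mul (isUnit_ex _ _)
  have hgd : gdist e p (ex 1 G') = hsNorm e W := by
    rw [← hKe]
    have hgs : star (ex (-(1/2)) G * ex (-ε) X) = ex (-ε) X * ex (-(1/2)) G := by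
      rw [star_mul, star_ex _ hXS.1, star_ex _ hGS.1]
    have c : ∀ r, ex (-(1/2)) G * ex (-ε) X * r * (ex (-ε) X * ex (-(1/2)) G) =
      ex (-(1/2)) G * (ex (-ε) X * r * ex (-ε) X) * ex (-(1/2)) G := fun r => by noncomm_ring
    refine gdist_eq (g := ex (-(1/2)) G * ex (-ε) X) hK.1 hW.1 ((isUnit_ex _ _).mul (isUnit_ex _ _)) ?_ ?_
    · rw [hgs, c, hKe, hp, conj_ex]
      have := ex_conj_one hGS.1
      rwa [star_ex _ hGS.1] at this
    · rw [hgs, c, hWe]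
  rw [← hp, gdist_comm (memP_exp hG'S) hpP, hgd]
  refine (norm_log_le hW hTu hTT hTT').trans ?_
  -- estimates
  obtain ⟨Q1, hQ1, hQ1e, hQ1n⟩ := piece (t := -ε) (s := 1/2) (ε := ε) hXS.2 hdHS
    (by rw [abs_neg, abs_of_pos hε]; exact hε1) (by rw [abs_of_pos] <;> norm_num) hGn' hG'n hXn
    (by rw [abs_neg, abs_of_pos hε]) hdn
  obtain ⟨Q2, hQ2, hQ2e, hQ2n⟩ := piece (t := ε) (s := -(1/2)) (ε := ε) hXS.2 hdHS
    (by rw [abs_of_pos hε]; exact hε1) (by rw [abs_neg, abs_of_pos] <;> norm_num) hGn' hG'n hXn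
    (by rw [abs_of_pos hε]) hdn
  obtain ⟨D, hD⟩ : ∃ D, D = ∫ s in (-(1/2) : ℝ)..(1/2), (DK G G' s V - DK G G s V) := ⟨_, rfl⟩
  have hDn : ‖D‖ ≤ Real.exp R' ^ 4 * M ^ 2 * ε := by
    have := intervalIntegral.norm_integral_le_of_norm_le_const (a := -(1/2)) (b := 1/2)
      (f := fun s => DK G G' s V - DK G G s V) (C := Real.exp R' ^ 4 * M ^ 2 * ε) (by
        intro s hs
        have hs' : |s| ≤ 1 := by
          rw [Set.uIoc_of_le (by norm_num)] at hs
          rw [abs_le]; constructor <;> linarith [hs.1, hs.2]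
        have hl := ex_lip hdHS hs' hGn' hG'n
        have : DK G G' s V - DK G G s V = HSp.mulL (ex (-s) G) (HSp.mulR (ex s G' - ex s G) V) := by
          apply HSp.op_inj
          rw [map_sub, op_DK, op_DK, HSp.op_mulL, HSp.op_mulR]
          noncomm_ring
        rw [this]
        have n1 := HSp.norm_mulL_le (ex (-s) G) (HSp.mulR (ex s G' - ex s G) V)
        have n2 := HSp.norm_mulR_le (ex s G' - ex s G) V
        have n3 : ‖ex (-s) G‖ ≤ Real.exp R' := norm_ex_le' (by rwa [abs_neg]) hGn'
        calc _ ≤ Real.exp R' * (M * (Real.exp R' ^ 3 * (ε * M))) := by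
              refine n1.trans ?_
              gcongr
              refine n2.trans ?_
              gcongr
              refine hl.trans ?_
              gcongr
          _ = _ := by ring)
    rw [← hD] at this
    refine this.trans (le_of_eq ?_)
    norm_num
  have hTe : T - T' = Q1 - Q2 + HSp.op (ε • D) := by
    have d1 := op_dI hdiff (-(1/2)) (1/2)
    rw [neg_neg] at d1
    have d2 : dI G G' (ε • V) (-(1/2)) (1/2) = ε • dI G G' V (-(1/2)) (1/2) := by
      unfold dI
      rw [← intervalIntegral.integral_smul]
      simp
    have d3 : D = dI G G' V (-(1/2)) (1/2) - dI G G V (-(1/2)) (1/2) := by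
      rw [hD, intervalIntegral.integral_sub ((DK_cont' G G' V).intervalIntegrable _ _)
        ((DK_cont' G G V).intervalIntegrable _ _)]
      rfl
    rw [d3, smul_sub, ← d2, map_sub, d1, hVd, map_smul, map_add, op_DK, op_DK, hXho, hQ1e, hQ2e, hT, hT']
    rw [neg_neg]
    simp only [smul_add, neg_smul]
    noncomm_ring
  rw [hTe]
  have hDh : hsNorm e (HSp.op (ε • D)) ≤ ε * (Real.exp R' ^ 4 * M ^ 2 * ε) := by
    rw [← HSp.norm_eq', norm_smul, Real.norm_of_nonneg hε.le]
    gcongr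
  have s1 := hsNorm_add_le (isHS_sub hQ1 hQ2) (HSp.isHS (ε • D))
  have s2 := hsNorm_sub_le hQ1 hQ2
  rw [← hx] at hQ1n hQ2n
  refine s1.trans ?_
  change hsNorm e (Q1 - Q2) + hsNorm e (HSp.op (ε • D)) ≤ _
  nlinarith


theorem gdist_one_conj {e : HilbertBasis ι ℂ H} {X q : H →L[ℂ] H} (hX : MemS2 e X) (t : ℝ) (hq : MemP e q) :
    gdist e 1 (ex t X * q * ex t X) ≤ 2 * |t| * hsNorm e X + gdist e 1 q := by
  have h1 := gdist_conj hX t (memP_one e) hq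
  rw [mul_one, ex_mul] at h1
  have h2 := gdist_triangle (memP_one e) (memP_ex hX (t + t)) (memP_conj hX t hq)
  have h3 := gdist_one (e := e) (hX.smul (t + t)).1
  rw [ex_smul, one_mul, hsNorm_smul e _ hX.2, ← two_mul, abs_mul, abs_two] at h3
  rw [h1, ← two_mul, h3] at h2
  exact h2

theorem gdist_self {e : HilbertBasis ι ℂ H} {X : H →L[ℂ] H} (hX : MemS2 e X) : gdist e (ex 1 X) (ex 1 X) = 0 := by
  have := gdist_mid hX (memS2_zero e) 0
  rw [ex_zero, mul_one, ex_mul, add_halves] at this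
  rw [this]; simp

/-- `exp E` is closed under `q ↦ e^X q e^X` -/
theorem conj_mem {e : HilbertBasis ι ℂ H} {E : Submodule ℝ (H →L[ℂ] H)}
    (hE : ∀ X ∈ E, MemS2 e X) (hclosed : IsHSClosed e (E : Set (H →L[ℂ] H)))
    (hbrk : ∀ X ∈ E, ∀ Y ∈ E, brk X (brk X Y) ∈ E) {X Y Z : H →L[ℂ] H} (hX : X ∈ E) (hY : Y ∈ E)
    (hZ : MemS2 e Z) (hZe : ex 1 Z = ex 1 X * ex 1 Y * ex 1 X) : Z ∈ E := by
  have hXS := hE X hX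
  have hYS := hE Y hY
  obtain ⟨C, hC0, hC⟩ := local_step hE hclosed hbrk hX (hsNorm e Y + 2 * hsNorm e X + 1)
  have hx := hsNorm_nonneg e X
  refine hclosed Z hZ fun δ hδ => ?_
  obtain ⟨N, hN⟩ := exists_nat_gt (max (max 1 C) (C / δ))
  have hN1 : (1:ℝ) < N := lt_of_le_of_lt ((le_max_left _ _).trans (le_max_left _ _)) hN
  have hNC : C < N := lt_of_le_of_lt ((le_max_right _ _).trans (le_max_left _ _)) hN
  have hNδ : C / δ < N := lt_of_le_of_lt (le_max_right _ _) hN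
  have hN0 : (0:ℝ) < N := by linarith
  obtain ⟨ε, hε⟩ : ∃ ε : ℝ, ε = 1 / N := ⟨_, rfl⟩
  have hNε : N * ε = 1 := by rw [hε]; field_simp
  have hε0 : 0 < ε := by rw [hε]; positivity
  have hε1 : ε ≤ 1 := by nlinarith
  have hCε : C * ε ≤ 1 := by nlinarith
  have key : ∀ k : ℕ, k ≤ N → ∃ G ∈ E, gdist e (ex 1 G) (ex (k * ε) X * ex 1 Y * ex (k * ε) X) ≤ k * (C * ε ^ 2) := by
    intro k
    induction k with
    | zero =>
      intro _
      refine ⟨Y, hY, ?_⟩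
      simp [ex_zero, gdist_self hYS]
    | succ k ih =>
      intro hk
      obtain ⟨G, hG, hGd⟩ := ih (by omega)
      have hGS := hE G hG
      have hkN : (k:ℝ) + 1 ≤ N := by exact_mod_cast hk
      have hk0 : (0:ℝ) ≤ k := by positivity
      have hkε : k * ε ≤ 1 := by nlinarith
      have hpk : MemP e (ex (k * ε) X * ex 1 Y * ex (k * ε) X) := memP_conj hXS _ (memP_exp hYS)
      have hGn : hsNorm e G ≤ hsNorm e Y + 2 * hsNorm e X + 1 := by
        have h1 := gdist_triangle (memP_one e) hpk (memP_exp hGS)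
        rw [gdist_one hGS.1, gdist_comm hpk (memP_exp hGS)] at h1
        have h2 := gdist_one_conj hXS (k * ε) (memP_exp hYS)
        rw [gdist_one hYS.1, abs_of_nonneg (by positivity)] at h2
        have h3 : k * (C * ε ^ 2) ≤ 1 := by
          calc k * (C * ε ^ 2) = (k * ε) * (C * ε) := by ring
            _ ≤ 1 * 1 := by gcongr
            _ = 1 := by ring
        have h4 : 2 * (k * ε) * hsNorm e X ≤ 2 * 1 * hsNorm e X := by gcongr
        linarith
      obtain ⟨G', hG', hG'd⟩ := hC ε hε0 hε1 G hG hGn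
      refine ⟨G', hG', ?_⟩
      have hstep : ex ((k + 1 : ℕ) * ε) X * ex 1 Y * ex ((k + 1 : ℕ) * ε) X =
          ex ε X * (ex (k * ε) X * ex 1 Y * ex (k * ε) X) * ex ε X := by
        have a1 : ex ((k + 1 : ℕ) * ε) X = ex ε X * ex (k * ε) X := by
          rw [ex_mul]; congr 1; push_cast; ring
        have a2 : ex ((k + 1 : ℕ) * ε) X = ex (k * ε) X * ex ε X := by
          rw [ex_mul]; congr 1; push_cast; ring
        calc _ = (ex ε X * ex (k * ε) X) * ex 1 Y * (ex (k * ε) X * ex ε X) := by rw [← a1, ← a2]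
          _ = _ := by noncomm_ring
      rw [hstep]
      have t := gdist_triangle (memP_exp (hE G' hG')) (memP_conj hXS ε (memP_exp hGS)) (memP_conj hXS ε hpk)
      rw [gdist_conj hXS ε (memP_exp hGS) hpk] at t
      push_cast
      linarith
  obtain ⟨G, hG, hGd⟩ := key N le_rfl
  refine ⟨G, hG, ?_⟩
  rw [hNε, ← hZe] at hGd
  refine (emi (hE G hG) hZ).trans_lt (hGd.trans_lt ?_)
  have : (N:ℝ) * (C * ε ^ 2) = C / N := by rw [hε]; field_simp
  rw [this]
  rw [div_lt_iff₀ hδ] at hNδ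
  rw [div_lt_iff₀ hN0]
  linarith

theorem conj_mem' {e : HilbertBasis ι ℂ H} {E : Submodule ℝ (H →L[ℂ] H)}
    (hE : ∀ X ∈ E, MemS2 e X) (hclosed : IsHSClosed e (E : Set (H →L[ℂ] H)))
    (hbrk : ∀ X ∈ E, ∀ Y ∈ E, brk X (brk X Y) ∈ E) {X Y : H →L[ℂ] H} (hX : X ∈ E) (hY : Y ∈ E) (t s : ℝ) :
    ∃ Z ∈ E, ex 1 Z = ex t X * ex s Y * ex t X := by
  obtain ⟨Z, hZ, hZe⟩ := (memP_conj (hE X hX) t (memP_ex (hE Y hY) s)).exists_log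
  refine ⟨Z, conj_mem hE hclosed hbrk (E.smul_mem t hX) (E.smul_mem s hY) hZ ?_, hZe⟩
  rw [hZe, ex_smul, ex_smul, one_mul, one_mul]

/-- Pythagorean inequality at the nearest point -/
theorem pyth {e : HilbertBasis ι ℂ H} {E : Submodule ℝ (H →L[ℂ] H)}
    (hE : ∀ X ∈ E, MemS2 e X) (hclosed : IsHSClosed e (E : Set (H →L[ℂ] H)))
    (hbrk : ∀ X ∈ E, ∀ Y ∈ E, brk X (brk X Y) ∈ E) {p X Y : H →L[ℂ] H} (hp : MemP e p) (hX : X ∈ E)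
    (hY : Y ∈ E) (hmin : ∀ Z ∈ E, gdist e p (ex 1 X) ≤ gdist e p (ex 1 Z)) :
    gdist e p (ex 1 X) ^ 2 + gdist e (ex 1 X) (ex 1 Y) ^ 2 ≤ gdist e p (ex 1 Y) ^ 2 := by
  obtain ⟨W, hW, hWe⟩ := conj_mem' hE hclosed hbrk hX hY (-(1/2)) 1
  have hXS := hE X hX
  have hWS := hE W hW
  have hYe : ex 1 Y = ex (1/2) X * ex 1 W * ex (1/2) X := by rw [hWe, conj_ex']
  rw [gdist_eq' hXS.1 hWS.1 hWe]
  have key : ∀ n : ℕ, (gdist e p (ex (1/2) X * ex ((1/2) ^ n) W * ex (1/2) X) ^ 2 - gdist e p (ex 1 X) ^ 2) ≤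
      (1/2) ^ n * (gdist e p (ex 1 Y) ^ 2 - gdist e p (ex 1 X) ^ 2 - (1 - (1/2) ^ n) * hsNorm e W ^ 2) := by
    intro n
    induction n with
    | zero => rw [pow_zero, ← hYe]; linarith
    | succ n ih =>
      have h := semipar hXS (hWS.smul ((1/2) ^ n)) hp
      rw [ex_smul, ex_smul, one_mul, hsNorm_smul e _ hWS.2, abs_of_pos (by positivity), ← pow_succ'] at h
      have hs : ((1:ℝ)/2) ^ (n + 1) = 1/2 * (1/2) ^ n := pow_succ' _ _
      have hr : ((1:ℝ)/2) ^ (n + 1) * (gdist e p (ex 1 Y) ^ 2 - gdist e p (ex 1 X) ^ 2 - (1 - (1/2) ^ (n + 1)) * hsNorm e W ^ 2)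
          = 1/2 * ((1/2) ^ n * (gdist e p (ex 1 Y) ^ 2 - gdist e p (ex 1 X) ^ 2 - (1 - (1/2) ^ n) * hsNorm e W ^ 2))
            - 1/4 * ((1/2) ^ n * hsNorm e W) ^ 2 := by
        rw [hs]; ring
      linarith
  have hge : ∀ n : ℕ, (1 - (1/2 : ℝ) ^ n) * hsNorm e W ^ 2 ≤ gdist e p (ex 1 Y) ^ 2 - gdist e p (ex 1 X) ^ 2 := by
    intro n
    obtain ⟨Z, hZ, hZe⟩ := conj_mem' hE hclosed hbrk hX hW (1/2) ((1/2) ^ n)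
    have h1 := hmin Z hZ
    rw [hZe] at h1
    have h2 := pow_le_pow_left₀ (gdist_nonneg e _ _) h1 2
    have h3 := key n
    have h4 : (0:ℝ) < (1/2) ^ n := by positivity
    have h5 : 0 ≤ (1/2 : ℝ) ^ n * (gdist e p (ex 1 Y) ^ 2 - gdist e p (ex 1 X) ^ 2 - (1 - (1/2) ^ n) * hsNorm e W ^ 2) := by
      linarith
    have h6 := nonneg_of_mul_nonneg_right h5 h4
    linarith
  have lim : Filter.Tendsto (fun n : ℕ => (1 - (1/2 : ℝ) ^ n) * hsNorm e W ^ 2) Filter.atTop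
      (nhds ((1 - 0) * hsNorm e W ^ 2)) :=
    ((tendsto_pow_atTop_nhds_zero_of_lt_one (by norm_num) (by norm_num)).const_sub 1).mul_const _
  have := le_of_tendsto' lim hge
  linarith

/-- The nearest-point projection of `P` onto `exp E` is 1-Lipschitz
for the geodesic distance. -/
theorem statement13 (e : HilbertBasis ι ℂ H) (E : Submodule ℝ (H →L[ℂ] H))
    (hE : ∀ X ∈ E, MemS2 e X) (hclosed : IsHSClosed e (E : Set (H →L[ℂ] H)))
    (hbrk : ∀ X ∈ E, ∀ Y ∈ E, brk X (brk X Y) ∈ E)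
    (p₁ p₂ q₁ q₂ : H →L[ℂ] H) (hp₁ : MemP e p₁) (hp₂ : MemP e p₂)
    (hq₁ : q₁ ∈ expSet (E : Set (H →L[ℂ] H))) (hq₂ : q₂ ∈ expSet (E : Set (H →L[ℂ] H)))
    (hmin₁ : gdist e p₁ q₁ = sInf (gdist e p₁ '' expSet (E : Set (H →L[ℂ] H))))
    (hmin₂ : gdist e p₂ q₂ = sInf (gdist e p₂ '' expSet (E : Set (H →L[ℂ] H)))) :
    gdist e q₁ q₂ ≤ gdist e p₁ p₂ := by
  have hm : ∀ p q, gdist e p q = sInf (gdist e p '' expSet (E : Set (H →L[ℂ] H))) →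
      ∀ Z ∈ E, gdist e p q ≤ gdist e p (ex 1 Z) := by
    intro p q h Z hZ
    rw [h]
    refine csInf_le ⟨0, ?_⟩ ⟨_, ⟨Z, hZ, rfl⟩, by rw [ex_one]⟩
    rintro _ ⟨y, _, rfl⟩
    exact gdist_nonneg e p y
  have m1 := hm _ _ hmin₁
  have m2 := hm _ _ hmin₂
  obtain ⟨X, hX, rfl⟩ := hq₁
  obtain ⟨Y, hY, rfl⟩ := hq₂
  rw [← ex_one, ← ex_one] at *
  have hXP := memP_exp (hE X hX)
  have hYP := memP_exp (hE Y hY)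
  have y1 := pyth hE hclosed hbrk hp₁ hX hY m1
  have y2 := pyth hE hclosed hbrk hp₂ hY hX m2
  have y3 := quad hp₁ hp₂ hYP hXP
  rw [gdist_comm hYP hXP] at y2 y3
  rw [gdist_comm hXP hp₁] at y3
  refine abs_le_of_sq_le_sq' (a := gdist e (ex 1 X) (ex 1 Y)) ?_ (gdist_nonneg e _ _) |>.2
  nlinarith
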